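/- arXiv:2103.05565 — 2 statements merged into one kernel-verified Lean document; each statement's English description precedes it below -/
import Mathlib

section
/- Let F₁, …, F₆ be (possibly infinite) families of nonempty compact connected sets in ℝ². Suppose that for every choice of indices 1 ≤ i₁ < i₂ < i₃ ≤ 6 and every choice of sets A₁ ∈ F_{i₁}, A₂ ∈ F_{i₂}, A₃ ∈ F_{i₃}, the triple A₁, A₂, A₃ is tight. Then there exists an index i ∈ {1,…,6} such that F_i is pierced by 3 lines. -/
open Set

/-- The Euclidean plane ℝ². -/
abbrev Plane := EuclideanSpace ℝ (Fin 2)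

/-- A line in the plane: a one-dimensional affine subspace of ℝ². -/
def IsLine (l : Set Plane) : Prop :=
  ∃ p v : Plane, v ≠ 0 ∧ l = {x | ∃ t : ℝ, x = p + t • v}

/-- A triple of sets `A, B, C` is tight if
`conv(A ∪ B) ∩ conv(A ∪ C) ∩ conv(B ∪ C) ≠ ∅`. -/
def Tight (A B C : Set Plane) : Prop :=
  (convexHull ℝ (A ∪ B) ∩ convexHull ℝ (A ∪ C) ∩ convexHull ℝ (B ∪ C)).Nonempty

/-- A family `F` of sets in the plane is pierced by `k` lines if there are `k` lines
such that every member of `F` intersects their union. -/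
def PiercedByLines (F : Set (Set Plane)) (k : ℕ) : Prop :=
  ∃ L : Fin k → Set Plane, (∀ i, IsLine (L i)) ∧ ∀ S ∈ F, (S ∩ ⋃ i, L i).Nonempty


noncomputable def LL (R s t : ℝ) (p : Plane) : ℝ :=
  p 0 * Real.cos ((s+t)/2) + p 1 * Real.sin ((s+t)/2) - R * Real.cos ((t-s)/2)

theorem LL_anti (R s t : ℝ) (p) : LL R t (s + 2 * Real.pi) p = - LL R s t p := by
  unfold LL
  rw [show (t + (s + 2*Real.pi))/2 = (s+t)/2 + Real.pi by ring,
    show (s + 2*Real.pi - t)/2 = Real.pi - (t-s)/2 by ring, Real.cos_add_pi, Real.sin_add_pi, Real.cos_pi_sub]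
  ring

theorem LL_self {R s : ℝ} (hR : 0 ≤ R) {p : Plane} (hp : ‖p‖ ≤ R) : LL R s s p ≤ 0 := by
  unfold LL
  have h1 : p 0 ^ 2 + p 1 ^ 2 ≤ R ^ 2 := by
    have := EuclideanSpace.real_norm_sq_eq p
    rw [Fin.sum_univ_two] at this
    rw [← this]
    gcongr
  have h2 := Real.sin_sq_add_cos_sq s
  simp only [sub_self, zero_div, Real.cos_zero, add_self_div_two]
  have : p 0 * Real.cos s + p 1 * Real.sin s ≤ R := by
    apply le_of_sq_le_sq _ hR
    nlinarith [sq_nonneg (p 0 * Real.sin s - p 1 * Real.cos s)]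
  linarith

theorem LL_three (R s t t' : ℝ) (p) : LL R s t' p * Real.sin ((t-s)/2) + LL R s s p * Real.sin ((t'-t)/2)
    = LL R s t p * Real.sin ((t'-s)/2) := by
  unfold LL
  obtain ⟨a, rfl⟩ : ∃ a, s = 2 * a := ⟨s/2, by ring⟩
  obtain ⟨b, rfl⟩ : ∃ a, t = 2 * a := ⟨t/2, by ring⟩
  obtain ⟨c, rfl⟩ : ∃ a, t' = 2 * a := ⟨t'/2, by ring⟩
  rw [show (2*a+2*c)/2 = a + c by ring, show (2*a+2*b)/2 = a + b by ring, show (2*a+2*a)/2 = a + a by ring,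
    show (2*c-2*a)/2 = c - a by ring, show (2*b-2*a)/2 = b - a by ring, show (2*a-2*a)/2 = 0 by ring,
    show (2*c-2*b)/2 = c - b by ring]
  simp only [Real.cos_add, Real.sin_add, Real.cos_sub, Real.sin_sub, Real.cos_zero]
  have ha := Real.sin_sq_add_cos_sq a
  have hb := Real.sin_sq_add_cos_sq b
  have hc := Real.sin_sq_add_cos_sq c
  generalize Real.sin a = sa at *
  generalize Real.sin b = sb at *
  generalize Real.sin c = sc at *
  generalize Real.cos a = ca at *
  generalize Real.cos b = cb at *
  generalize Real.cos c = cc at *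
  generalize p 0 = x
  generalize p 1 = y
  linear_combination (-(R * (sb * cc - sc * cb))) * ha 

theorem LL_mono {R s t t' : ℝ} (hR : 0 ≤ R) {p : Plane} (hp : ‖p‖ ≤ R) (h1 : s ≤ t) (h2 : t ≤ t')
    (h3 : t' ≤ s + 2 * Real.pi) (h : 0 < LL R s t p) : 0 ≤ LL R s t' p := by
  have h0 := LL_self (s := s) hR hp
  have key := LL_three R s t t' p
  have s1 : 0 ≤ Real.sin ((t'-t)/2) := Real.sin_nonneg_of_nonneg_of_le_pi (by linarith) (by linarith)
  have s2 : 0 ≤ Real.sin ((t'-s)/2) := Real.sin_nonneg_of_nonneg_of_le_pi (by linarith) (by linarith)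
  rcases h1.eq_or_lt with rfl | h1
  · linarith
  rcases h2.eq_or_lt with rfl | h2
  · exact h.le
  have s3 : 0 < Real.sin ((t-s)/2) := Real.sin_pos_of_pos_of_lt_pi (by linarith) (by linarith)
  by_contra hn
  push Not at hn
  nlinarith [mul_pos_of_neg_of_neg hn (neg_neg_of_pos s3), mul_nonneg h.le s2, mul_nonneg (neg_nonneg.2 h0) s1]

theorem LL_final {R t0 t1 t2 t3 t4 t5 : ℝ} (h01 : t0 ≤ t1) (h12 : t1 ≤ t2) (h23 : t2 ≤ t3) (h34 : t3 ≤ t4)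
    (h45 : t4 ≤ t5) (h50 : t5 ≤ t0 + 2 * Real.pi) {p q : Plane}
    (p1 : 0 < LL R t0 t3 p) (p2 : LL R t1 t4 p < 0) (p3 : 0 < LL R t2 t5 p)
    (q1 : LL R t0 t3 q < 0) (q2 : 0 < LL R t1 t4 q) (q3 : LL R t2 t5 q < 0) : False := by
  unfold LL at *
  have e1 : (t0+t3)/2 ≤ (t1+t4)/2 := by linarith
  have e2 : (t1+t4)/2 ≤ (t2+t5)/2 := by linarith
  have e3 : (t2+t5)/2 ≤ (t0+t3)/2 + Real.pi := by linarith
  generalize (t0+t3)/2 = a at *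
  generalize (t1+t4)/2 = b at *
  generalize (t2+t5)/2 = c at *
  generalize R * Real.cos ((t3-t0)/2) = r1 at *
  generalize R * Real.cos ((t4-t1)/2) = r2 at *
  generalize R * Real.cos ((t5-t2)/2) = r3 at *
  rcases e1.eq_or_lt with rfl | e1
  · linarith
  rcases e2.eq_or_lt with rfl | e2
  · linarith
  have s1 : 0 < Real.sin (b-a) := Real.sin_pos_of_pos_of_lt_pi (by linarith) (by linarith)
  have s2 : 0 < Real.sin (c-b) := Real.sin_pos_of_pos_of_lt_pi (by linarith) (by linarith)
  have s3 : 0 ≤ Real.sin (c-a) := Real.sin_nonneg_of_nonneg_of_le_pi (by linarith) (by linarith)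
  have d1 : Real.cos b * Real.sin (c-a) = Real.cos a * Real.sin (c-b) + Real.cos c * Real.sin (b-a) := by
    simp only [Real.sin_sub]; ring
  have d2 : Real.sin b * Real.sin (c-a) = Real.sin a * Real.sin (c-b) + Real.sin c * Real.sin (b-a) := by
    simp only [Real.sin_sub]; ring
  have P1 := mul_pos p1 s2
  have P2 := mul_nonneg (neg_nonneg.2 p2.le) s3
  have P3 := mul_pos p3 s1
  have Q1 := mul_pos (neg_pos.2 q1) s2
  have Q2 := mul_nonneg q2.le s3
  have Q3 := mul_pos (neg_pos.2 q3) s1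
  have id1 : ∀ x y : ℝ, (x * Real.cos a + y * Real.sin a - r1) * Real.sin (c-b)
     - (x * Real.cos b + y * Real.sin b - r2) * Real.sin (c-a) + (x * Real.cos c + y * Real.sin c - r3) * Real.sin (b-a)
     = - r1 * Real.sin (c-b) + r2 * Real.sin (c-a) - r3 * Real.sin (b-a) := by
    intro x y
    linear_combination (-x) * d1 - y * d2
  have i1 := id1 (p 0) (p 1)
  have i2 := id1 (q 0) (q 1)
  linarith
theorem even_inv {α : Type*} [DecidableEq α] (X : Finset α) (f : α → α) (h1 : ∀ a ∈ X, f a ∈ X)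
  (h2 : ∀ a ∈ X, f (f a) = a) (h3 : ∀ a ∈ X, f a ≠ a) : Even X.card := by
  have := Finset.sum_involution (s := X) (f := fun _ => (1 : ZMod 2)) (fun a _ => f a)
    (fun a _ => by decide) (fun a ha _ => h3 a ha) (fun a ha => h1 a ha) (fun a ha => h2 a ha)
  simp at this
  exact (ZMod.natCast_eq_zero_iff_even).1 this

abbrev I6 := ZMod 6
def dd (a : I6) : I6 → ℤ := Pi.single (a+1) 1 - Pi.single a 1
def wt (y : I6 → ℤ) : I6 := ∑ i, (y i : I6) * i
def IsSx (v : I6 → I6 → ℤ) : Prop := ∃ σ : Equiv.Perm I6, ∀ k, v (k+1) = v k + dd (σ k)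
def fl (k : I6) (v : I6 → I6 → ℤ) : I6 → I6 → ℤ := Function.update v k (v (k-1) + v (k+1) - v k)
structure Tri (N : ℤ) (v : I6 → I6 → ℤ) : Prop where
  sx : IsSx v
  wt : ∀ k, wt (v k) = k
  sum : ∀ k, ∑ i, v k i = N

theorem wt_add (y z) : wt (y + z) = wt y + wt z := by
  simp [wt, add_mul, Finset.sum_add_distrib]
theorem wt_sub (y z) : wt (y - z) = wt y - wt z := by
  simp [wt, sub_mul, Finset.sum_sub_distrib]
theorem wt_single (i : I6) (c : ℤ) : wt (Pi.single i c) = c * i := by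
  simp only [wt]
  rw [Finset.sum_eq_single i]
  · simp
  · intro b _ hb; simp [hb]
  · simp
theorem dd_inj : ∀ a b : I6, dd a = dd b → a = b := by decide
theorem dd_le : ∀ a i : I6, dd a i ≤ if a + 1 = i then 1 else 0 := by decide
theorem ne1 : ∀ k : I6, k + 1 ≠ k := by decide
theorem ne2 : ∀ k : I6, k - 1 ≠ k := by decide

theorem IsSx.range {v} (h : IsSx v) (j k i : I6) : v j i ≤ v k i + 1 := by
  obtain ⟨σ, h⟩ := h
  have key : ∀ t : ℕ, v (k + t) i = v k i + ∑ r ∈ Finset.range t, dd (σ (k + r)) i := by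
    intro t
    induction t with
    | zero => simp
    | succ t ih =>
      rw [Finset.sum_range_succ, ← add_assoc, ← ih]
      have := congrFun (h (k + t)) i
      push_cast
      rw [← add_assoc, this]; rfl
  have hj : j = k + ((j - k).val : ℕ) := by simp
  have hlt := ZMod.val_lt (j - k)
  rw [hj, key]
  generalize (j-k).val = t at hlt
  have h1 : ∀ a, dd a i ≤ if a + 1 = i then 1 else 0 := by
    exact fun a => dd_le a i
  have h2 : ∑ r ∈ Finset.range t, dd (σ (k + r)) i ≤ 1 := by
    calc _ ≤ ∑ r ∈ Finset.range t, (if σ (k + r) + 1 = i then 1 else 0 : ℤ) := Finset.sum_le_sum fun r _ => h1 _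
      _ = ((Finset.range t).filter (fun r : ℕ => σ (k + r) + 1 = i)).card := by
        simp
      _ ≤ 1 := by
        norm_cast
        rw [Finset.card_le_one]
        intro a ha b hb
        simp only [Finset.mem_filter, Finset.mem_range] at ha hb
        have h3 : σ (k + a) = σ (k + b) := add_right_cancel (ha.2.trans hb.2.symm)
        have h4 := add_left_cancel (σ.injective h3)
        rw [ZMod.natCast_eq_natCast_iff'] at h4
        omega
  linarith

theorem fl_self (k v) : fl k v k = v (k-1) + v (k+1) - v k := by simp [fl]
theorem fl_ne {k j} (v) (h : j ≠ k) : fl k v j = v j := by simp [fl, h]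
theorem fl_fl (k v) : fl k (fl k v) = v := by
  funext j
  by_cases h : j = k
  · subst h; rw [fl_self, fl_self, fl_ne _ (ne1 _), fl_ne _ (ne2 _)]; abel
  · rw [fl_ne _ h, fl_ne _ h]

theorem fl_nefix {v} (h : IsSx v) (k) : fl k v ≠ v := by
  obtain ⟨σ, h⟩ := h
  intro hh
  have h1 := congrFun hh k
  rw [fl_self, h k] at h1
  have h2 := h (k-1)
  rw [sub_add_cancel] at h2
  rw [h2] at h1
  have : dd (σ k) = dd (σ (k-1)) := by
    have h3 : dd (σ k) = (v (k - 1) + (v (k - 1) + dd (σ (k - 1)) + dd (σ k)) - (v (k - 1) + dd (σ (k - 1)))) - v (k-1) := by abel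
    rw [h3, h1]; abel
  have := σ.injective (dd_inj _ _ this)
  exact ne2 k this.symm

theorem IsSx.fl {v} (h : IsSx v) (k) : IsSx (fl k v) := by
  obtain ⟨σ, h⟩ := h
  have h2 := h (k-1)
  rw [sub_add_cancel] at h2
  refine ⟨σ * Equiv.swap (k-1) k, fun j => ?_⟩
  rw [Equiv.Perm.mul_apply]
  by_cases h3 : j = k
  · subst h3
    rw [Equiv.swap_apply_right, fl_self, fl_ne _ (ne1 _), h2]; abel
  · by_cases h4 : j = k - 1
    · subst h4
      rw [Equiv.swap_apply_left, sub_add_cancel, fl_self, fl_ne _ (ne2 _), h k]; abel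
    · rw [Equiv.swap_apply_of_ne_of_ne h4 h3, fl_ne _ h3, fl_ne _ (by rintro rfl; simp at h4), h]

theorem Tri.fl {N v} (h : Tri N v) (k) : Tri N (fl k v) := by
  refine ⟨h.sx.fl k, fun j => ?_, fun j => ?_⟩
  · by_cases h3 : j = k
    · subst h3
      rw [fl_self, wt_sub, wt_add, h.wt, h.wt, h.wt]; ring
    · rw [fl_ne _ h3, h.wt]
  · by_cases h3 : j = k
    · subst h3
      rw [fl_self]
      simp [Finset.sum_add_distrib, h.sum]
    · rw [fl_ne _ h3, h.sum]

def Dr (L : I6 → I6) (k : I6) : Prop := ∀ c, c ≠ 0 → ∃ j, j ≠ k ∧ L j = c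

theorem Dr.spec {L k} (h : Dr L k) : (∀ i j, i ≠ k → j ≠ k → L i = L j → i = j) ∧ ∀ j, j ≠ k → L j ≠ 0 := by
  have hsub : (Finset.univ.erase (0:I6)) ⊆ (Finset.univ.erase k).image L := by
    intro c hc
    obtain ⟨j, hj, rfl⟩ := h c (by simpa using hc)
    exact Finset.mem_image_of_mem _ (by simpa using hj)
  have hc : ∀ a : I6, (Finset.univ.erase a).card = 5 := by decide
  have hle : ((Finset.univ.erase k).image L).card ≤ (Finset.univ.erase k).card := Finset.card_image_le
  have heq := Finset.eq_of_subset_of_card_le hsub (by rw [hc]; rwa [hc] at hle)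
  constructor
  · have := Finset.card_image_iff.1 (show ((Finset.univ.erase k).image L).card = (Finset.univ.erase k).card by rw [← heq, hc, hc])
    intro i j hi hj hij
    exact this (by simpa using hi) (by simpa using hj) hij
  · intro j hj h0
    have : L j ∈ Finset.univ.erase (0:I6) := by
      rw [heq]; exact Finset.mem_image_of_mem _ (by simpa using hj)
    simp [h0] at this

open Classical in
noncomputable def oth (L : I6 → I6) (k : I6) : I6 :=
  if h : ∃ j, j ≠ k ∧ L j = L k then h.choose else k

theorem oth_spec {L k} (h : ∃ j, j ≠ k ∧ L j = L k) : oth L k ≠ k ∧ L (oth L k) = L k := by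
  rw [oth, dif_pos h]; exact h.choose_spec

theorem Dr.oth {L k} (h : Dr L k) (hL : ¬ Function.Surjective L) :
    oth L k ≠ k ∧ Dr L (oth L k) ∧ oth L (oth L k) = k := by
  have hk : L k ≠ 0 := by
    intro h0
    apply hL
    intro c
    by_cases hc : c = 0
    · exact ⟨k, by rw [h0, hc]⟩
    · obtain ⟨j, _, hj⟩ := h c hc
      exact ⟨j, hj⟩
  obtain ⟨h1, h2⟩ := oth_spec (h _ hk)
  obtain ⟨h3, h4⟩ := oth_spec (L := L) (k := _root_.oth L k) ⟨k, h1.symm, h2.symm⟩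
  refine ⟨h1, ?_, ?_⟩
  · intro c hc
    obtain ⟨j, hj, hjc⟩ := h c hc
    by_cases hh : j = _root_.oth L k
    · exact ⟨k, h1.symm, by rw [← h2, ← hh, hjc]⟩
    · exact ⟨j, hh, hjc⟩
  · by_contra h5
    exact h3 (h.spec.1 _ _ h5 h1 h4)

/-- the base vertices -/
def bw (N : ℤ) (c : I6) : I6 → ℤ := Pi.single 1 (N-1) + Pi.single c 1

theorem bw_tri (N : ℤ) : Tri N (fun k => bw N (k - ((N-1 : ℤ) : I6))) := by
  refine ⟨⟨Equiv.subRight ((N-1 : ℤ) : I6), fun k => ?_⟩, fun k => ?_, fun k => ?_⟩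
  · simp only [bw, dd, Equiv.subRight_apply]
    rw [show k + 1 - ((N-1 : ℤ) : I6) = k - ((N-1 : ℤ) : I6) + 1 by ring]
    abel
  · simp only [bw, wt_add, wt_single]; push_cast; ring
  · simp [bw, Finset.sum_add_distrib]

theorem bw_nonneg {N : ℤ} (hN : 1 ≤ N) (c i) : 0 ≤ bw N c i := by
  simp only [bw, Pi.add_apply, Pi.single_apply]
  split_ifs <;> omega

theorem sum6 (y : I6 → ℤ) : ∑ i, y i = y 0 + y 1 + y 2 + y 3 + y 4 + y 5 := Fin.sum_univ_six y

theorem funext6 {y z : I6 → ℤ} (h0 : y 0 = z 0) (h1 : y 1 = z 1) (h2 : y 2 = z 2) (h3 : y 3 = z 3)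
   (h4 : y 4 = z 4) (h5 : y 5 = z 5) : y = z := by
  funext i
  have : i = 0 ∨ i = 1 ∨ i = 2 ∨ i = 3 ∨ i = 4 ∨ i = 5 := by revert i; decide
  rcases this with rfl | rfl | rfl | rfl | rfl | rfl <;> assumption

theorem cases6 (i : I6) : i = 0 ∨ i = 1 ∨ i = 2 ∨ i = 3 ∨ i = 4 ∨ i = 5 := by revert i; decide

theorem bw_label {N : ℤ} (hN : 1 ≤ N) (c i : I6) (hc : c ≠ 0) (h1 : 0 < bw N c i)
    (h2 : ∀ j : I6, i.val < j.val → bw N c j = 0) : i = c := by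
  by_contra hne
  have h1' : i = 1 := by
    by_contra h
    simp [bw, h, hne] at h1
  subst h1'
  have := h2 c (by
    rcases cases6 c with rfl | rfl | rfl | rfl | rfl | rfl <;> first | decide | contradiction)
  simp only [bw, Pi.add_apply, Pi.single_apply] at this
  split_ifs at this <;> omega

/-- base facet uniqueness -/
theorem base_unique {N : ℤ} (hN : 1 ≤ N) {y z : I6 → ℤ} (hy : ∀ i, 0 ≤ y i) (hz : ∀ i, 0 ≤ z i)
    (sy : ∑ i, y i = N) (sz : ∑ i, z i = N) (hy0 : y 0 = 0)
    (hy1 : ∀ j : I6, (1 : I6).val < j.val → y j = 0) (c : I6) (hc : c ≠ 0) (hr : y 1 ≤ z 1 + 1) (hz0 : z 0 = 0)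
    (hzc : 0 < z c) (hz1 : ∀ j : I6, c.val < j.val → z j = 0) : z = bw N c := by
  have a2 := hy1 2 (by decide)
  have a3 := hy1 3 (by decide)
  have a4 := hy1 4 (by decide)
  have a5 := hy1 5 (by decide)
  rw [sum6] at sy sz
  have b1 := hz 1
  have b2 := hz 2
  have b3 := hz 3
  have b4 := hz 4
  have b5 := hz 5
  rcases cases6 c with rfl | rfl | rfl | rfl | rfl | rfl
  · exact absurd rfl hc
  · have c2 := hz1 2 (by decide)
    have c3 := hz1 3 (by decide)
    have c4 := hz1 4 (by decide)
    have c5 := hz1 5 (by decide)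
    apply funext6 <;> simp only [bw, Pi.add_apply, Pi.single_apply] <;>
      (repeat first | rw [if_neg (by decide)] | rw [if_pos (by decide)]) <;> omega
  all_goals
    apply funext6 <;> simp only [bw, Pi.add_apply, Pi.single_apply] <;> 
      (repeat first | rw [if_neg (by decide)] | rw [if_pos (by decide)]) <;> omega

theorem sperner (N : ℤ) (hN : 1 ≤ N) (lam : (I6 → ℤ) → I6)
    (h1 : ∀ y : I6 → ℤ, (∀ i, 0 ≤ y i) → ∑ i, y i = N → lam y ≠ 0 → 0 < y (lam y))
    (h0 : ∀ y : I6 → ℤ, (∀ i, 0 ≤ y i) → ∑ i, y i = N → y 0 = 0 →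
      0 < y (lam y) ∧ ∀ i : I6, (lam y).val < i.val → y i = 0) :
    ∃ v, Tri N v ∧ (∀ k i, 0 ≤ v k i) ∧ Function.Surjective (fun k => lam (v k)) := by
  classical
  by_contra hcon
  push Not at hcon
  have hfinT : {v : I6 → I6 → ℤ | Tri N v ∧ ∀ k i, 0 ≤ v k i}.Finite := by
    apply Set.Finite.subset (Set.finite_Icc (0 : I6 → I6 → ℤ) (fun _ _ => N))
    rintro v ⟨hv, hp⟩
    refine ⟨fun k i => hp k i, fun k i => ?_⟩
    rw [← hv.sum k]
    exact Finset.single_le_sum (f := v k) (fun j _ => hp k j) (Finset.mem_univ i)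
  have hfin : {p : (I6 → I6 → ℤ) × I6 | (Tri N p.1 ∧ ∀ k i, 0 ≤ p.1 k i) ∧ Dr (fun k => lam (p.1 k)) p.2}.Finite := by
    apply Set.Finite.subset (hfinT.prod (Set.finite_univ (α := I6)))
    rintro ⟨v, k⟩ ⟨h, _⟩
    exact ⟨h, trivial⟩
  set X := hfin.toFinset with hX
  have memX : ∀ v k, (v, k) ∈ X ↔ (Tri N v ∧ ∀ k i, 0 ≤ v k i) ∧ Dr (fun k => lam (v k)) k := by
    intro v k; simp [hX]
  -- first parity
  have e1 : Even X.card := by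
    apply even_inv X (fun p => (p.1, oth (fun k => lam (p.1 k)) p.2))
    · rintro ⟨v, k⟩ h
      rw [memX] at h
      rw [memX]
      exact ⟨h.1, (h.2.oth (hcon v h.1.1 h.1.2)).2.1⟩
    · rintro ⟨v, k⟩ h
      rw [memX] at h
      simp only [(h.2.oth (hcon v h.1.1 h.1.2)).2.2]
    · rintro ⟨v, k⟩ h
      rw [memX] at h
      intro hh
      exact (h.2.oth (hcon v h.1.1 h.1.2)).1 (congrArg Prod.snd hh)
  -- base
  set m : I6 := ((N - 1 : ℤ) : I6) with hm
  set b : (I6 → I6 → ℤ) × I6 := (fun k => bw N (k - m), m) with hb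
  have lamb : ∀ c : I6, c ≠ 0 → lam (bw N c) = c := by
    intro c hc
    have hs : ∑ i, bw N c i = N := by simp [bw, Finset.sum_add_distrib]
    obtain ⟨g1, g2⟩ := h0 (bw N c) (bw_nonneg hN c) hs (by
      simp only [bw, Pi.add_apply, Pi.single_apply]
      rw [if_neg (by decide), if_neg hc.symm]; rfl)
    exact bw_label hN c _ hc g1 g2
  have hbX : b ∈ X := by
    rw [memX]
    refine ⟨⟨bw_tri N, fun k i => bw_nonneg hN _ _⟩, fun c hc => ⟨c + m, by simpa using hc, ?_⟩⟩
    simpa using lamb c hc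
  -- flip stays nonneg unless boundary
  have key : ∀ v k, (v, k) ∈ X → ¬ (∀ j i, 0 ≤ fl k v j i) → (v, k) = b := by
    intro v k h hneg
    rw [memX] at h
    obtain ⟨⟨hT, hp⟩, hD⟩ := h
    have hT' := hT.fl k
    -- coordinate zero of the flipped vertex is negative
    have hneg0 : fl k v k 0 < 0 := by
      by_contra hge
      apply hneg
      intro j i
      by_cases hj : j = k
      · subst hj
        by_cases hi : i = 0
        · subst hi; exact not_lt.1 hge
        · obtain ⟨j', hj', hl⟩ := hD i hi
          have := h1 (v j') (hp j') (hT.sum j') (by simp only at hl; rwa [hl])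
          simp only at hl
          rw [hl] at this
          have h3 := hT'.sx.range j' j i
          rw [fl_ne _ hj'] at h3
          omega
      · rw [fl_ne _ hj]; exact hp j i
    have hz : ∀ j, j ≠ k → v j 0 = 0 := by
      intro j hj
      have h3 := hT'.sx.range j k 0
      rw [fl_ne _ hj] at h3
      have := hp j 0
      omega
    obtain ⟨j1, hj1, hl1⟩ := hD 1 (by decide)
    simp only at hl1
    have hw : ∀ c : I6, c ≠ 0 → ∃ j, j ≠ k ∧ v j = bw N c := by
      intro c hc
      obtain ⟨j, hj, hl⟩ := hD c hc
      simp only at hl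
      obtain ⟨q1, q2⟩ := h0 (v j1) (hp j1) (hT.sum j1) (hz _ hj1)
      obtain ⟨q3, q4⟩ := h0 (v j) (hp j) (hT.sum j) (hz _ hj)
      rw [hl1] at q1 q2
      rw [hl] at q3 q4
      exact ⟨j, hj, base_unique hN (hp j1) (hp j) (hT.sum j1) (hT.sum j) (hz _ hj1) q2 c hc
        (hT.sx.range j1 j 1) (hz _ hj) q3 q4⟩
    have hw' : ∀ c : I6, c ≠ 0 → c + m ≠ k ∧ v (c + m) = bw N c := by
      intro c hc
      obtain ⟨j, hj, hl⟩ := hw c hc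
      have e1 := hT.wt j
      have e2 := (bw_tri N).wt (c + m)
      simp only [hm, add_sub_cancel_right] at e2
      rw [hl, e2] at e1
      rw [hm, e1]
      exact ⟨hj, hl⟩
    have hkm : k = m := by
      by_contra hne
      exact (hw' (k - m) (sub_ne_zero.2 hne)).1 (by ring)
    subst hkm
    have hvk : v m = bw N 0 := by
      have f1 := hz (m+1) (ne1 m)
      have f2 := hz (m-1) (ne2 m)
      rw [fl_self] at hneg0
      simp only [Pi.add_apply, Pi.sub_apply] at hneg0
      obtain ⟨σ, hσ⟩ := hT.sx
      have f3 := hσ (m-1)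
      rw [sub_add_cancel] at f3
      have f4 : dd (σ (m-1)) 0 > 0 := by
        have := congrFun f3 0
        simp only [Pi.add_apply] at this
        omega
      have f5 : ∀ a : I6, dd a 0 > 0 → a = 5 := by decide
      have f6 := (hw' 5 (by decide)).2
      rw [show (5 : I6) + m = m - 1 by rw [sub_eq_add_neg, add_comm]; congr 1] at f6
      rw [f3, f5 _ f4, f6]
      simp only [bw, dd]
      rw [show (5 : I6) + 1 = 0 by decide]
      abel
    rw [hb]
    congr 1
    funext j
    by_cases hj : j = m
    · subst hj; simpa using hvk
    · have := (hw' (j - m) (sub_ne_zero.2 hj)).2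
      simpa using this
  have hbneg : ¬ ∀ j i, 0 ≤ fl b.2 b.1 j i := by
    intro h
    have h3 := h m 0
    simp only [hb] at h3
    rw [fl_self] at h3
    simp only [add_sub_cancel_left, sub_self, Pi.add_apply, Pi.sub_apply] at h3
    rw [show m - 1 - m = -1 by ring] at h3
    have h4 : bw N (-1) 0 = 0 := by
      simp only [bw, Pi.add_apply, Pi.single_apply]
      rw [if_neg (by decide), if_neg (by decide)]; rfl
    have h5 : bw N 1 0 = 0 := by
      simp only [bw, Pi.add_apply, Pi.single_apply]
      rw [if_neg (by decide), if_neg (by decide)]; rfl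
    have h6 : bw N 0 0 = 1 := by
      simp only [bw, Pi.add_apply, Pi.single_apply]
      rw [if_neg (by decide), if_pos trivial]; rfl
    omega
  have e2 : Even (X.erase b).card := by
    apply even_inv (X.erase b) (fun p => (fl p.2 p.1, p.2))
    · rintro ⟨v, k⟩ h
      rw [Finset.mem_erase] at h
      have hn : ∀ j i, 0 ≤ fl k v j i := by
        by_contra hh
        exact h.1 (key v k h.2 hh)
      have hx := (memX v k).1 h.2
      rw [Finset.mem_erase]
      constructor
      · intro hh
        apply hbneg
        rw [← hh]
        simp only [fl_fl]
        exact hx.1.2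
      · rw [memX]
        refine ⟨⟨hx.1.1.fl k, hn⟩, fun c hc => ?_⟩
        obtain ⟨j, hj, hl⟩ := hx.2 c hc
        exact ⟨j, hj, by simpa only [fl_ne _ hj] using hl⟩
    · rintro ⟨v, k⟩ h
      simp only [fl_fl]
    · rintro ⟨v, k⟩ h hh
      rw [Finset.mem_erase] at h
      exact fl_nefix ((memX v k).1 h.2).1.1.sx k (congrArg Prod.fst hh)
  have := Finset.card_erase_add_one hbX
  rw [← this] at e1
  exact (Nat.even_add_one.1 e1) e2

theorem exists_top (y : I6 → ℤ) (hp : ∀ i, 0 ≤ y i) (hs : 0 < ∑ i, y i) :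
    ∃ i : I6, 0 < y i ∧ ∀ j : I6, i.val < j.val → y j = 0 := by
  classical
  have hne : (Finset.univ.filter (fun i => 0 < y i)).Nonempty := by
    by_contra hn
    rw [Finset.not_nonempty_iff_eq_empty, Finset.filter_eq_empty_iff] at hn
    have : ∑ i, y i ≤ 0 := Finset.sum_nonpos fun i _ => not_lt.1 (hn (Finset.mem_univ i))
    omega
  obtain ⟨i, hi, hmax⟩ := Finset.exists_max_image _ (fun i : I6 => i.val) hne
  refine ⟨i, by simpa using hi, fun j hj => ?_⟩
  by_contra h
  have := hmax j (by simpa using lt_of_le_of_ne (hp j) (Ne.symm h))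
  omega

theorem ckkm (A : I6 → I6 → Set (I6 → ℝ)) (hopen : ∀ j i, IsOpen (A j i))
    (hcov : ∀ j, ∀ x ∈ stdSimplex ℝ I6, ∃ i, x ∈ A j i)
    (hbd : ∀ j i, ∀ x ∈ stdSimplex ℝ I6, x i = 0 → x ∉ A j i) :
    ∃ x ∈ stdSimplex ℝ I6, ∃ f : I6 → I6, Function.Injective f ∧ ∀ i, x ∈ A (f i) i := by
  have hleb : ∀ j, ∃ δ > 0, ∀ x ∈ stdSimplex ℝ I6, ∃ i, Metric.ball x δ ⊆ A j i := fun j =>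
    lebesgue_number_lemma_of_metric (isCompact_stdSimplex ℝ I6) (hopen j)
      (fun x hx => Set.mem_iUnion.2 (hcov j x hx))
  choose d hd hleb using hleb
  obtain ⟨j0, hj0⟩ := Finite.exists_min d
  obtain ⟨M, hM⟩ := exists_nat_one_div_lt (hd j0)
  have hMp : (0:ℝ) < M + 1 := by positivity
  set N : ℤ := M + 2 with hN
  set xx : (I6 → ℤ) → I6 → ℝ := fun y i => ((y i : ℝ) - if i = 0 then 1 else 0) / (M + 1) with hxx
  have hin : ∀ y : I6 → ℤ, (∀ i, 0 ≤ y i) → ∑ i, y i = N → 1 ≤ y 0 → xx y ∈ stdSimplex ℝ I6 := by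
    intro y hy hs h1
    refine ⟨fun i => ?_, ?_⟩
    · simp only [hxx]
      apply div_nonneg _ hMp.le
      split_ifs with h
      · subst h
        have : (1:ℝ) ≤ y 0 := by exact_mod_cast h1
        linarith
      · have : (0:ℝ) ≤ y i := by exact_mod_cast hy i
        linarith
    · simp only [hxx]
      rw [← Finset.sum_div, Finset.sum_sub_distrib, ← Int.cast_sum, hs]
      simp only [Finset.sum_ite_eq', Finset.mem_univ, if_true, hN]
      push_cast
      field_simp
      ring
  have hlab : ∀ y : I6 → ℤ, ∃ i : I6, (∀ i, 0 ≤ y i) → ∑ i, y i = N →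
      (1 ≤ y 0 → Metric.ball (xx y) (d j0) ⊆ A (wt y) i) ∧
      (y 0 = 0 → 0 < y i ∧ ∀ j : I6, i.val < j.val → y j = 0) := by
    intro y
    by_cases h : (∀ i, 0 ≤ y i) ∧ ∑ i, y i = N
    · obtain ⟨h1, h2⟩ := h
      by_cases h3 : y 0 = 0
      · obtain ⟨i, hi⟩ := exists_top y h1 (by omega)
        exact ⟨i, fun _ _ => ⟨fun h => by omega, fun _ => hi⟩⟩
      · obtain ⟨i, hi⟩ := hleb (wt y) (xx y) (hin y h1 h2 (by have := h1 0; omega))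
        exact ⟨i, fun _ _ => ⟨fun _ => (Metric.ball_subset_ball (hj0 _)).trans hi, fun h => absurd h h3⟩⟩
    · exact ⟨0, fun a b => absurd ⟨a, b⟩ h⟩
  choose lam hlam using hlab
  have hpos : ∀ y : I6 → ℤ, (∀ i, 0 ≤ y i) → ∑ i, y i = N → 1 ≤ y 0 →
      (if lam y = 0 then 1 else 0) < y (lam y) := by
    intro y h1 h2 h3
    have h4 := (hlam y h1 h2).1 h3 (Metric.mem_ball_self (hd j0))
    have h5 : xx y (lam y) ≠ 0 := fun h => hbd _ _ _ (hin y h1 h2 h3) h h4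
    have h6 : y (lam y) ≠ if lam y = 0 then 1 else 0 := by
      intro h
      apply h5
      simp only [hxx, h]
      push_cast
      simp
    split_ifs at h6 ⊢ with h
    · rw [h] at h6 ⊢; omega
    · have := h1 (lam y); omega
  obtain ⟨v, hT, hv, hsur⟩ := sperner N (by omega) lam (by
      intro y h1 h2 h3
      by_cases h4 : y 0 = 0
      · exact ((hlam y h1 h2).2 h4).1
      · have := hpos y h1 h2 (by have := h1 0; omega)
        rwa [if_neg h3] at this) (fun y h1 h2 h3 => (hlam y h1 h2).2 h3)
  obtain ⟨k0, hk0⟩ := hsur 0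
  simp only at hk0
  have hk1 : v k0 0 ≠ 0 := by
    intro h
    have := ((hlam _ (hv k0) (hT.sum k0)).2 h).1
    rw [hk0] at this
    omega
  have hk2 : 1 < v k0 0 := by
    have := hpos (v k0) (hv k0) (hT.sum k0) (by have := hv k0 0; omega)
    rw [if_pos hk0, hk0] at this
    exact this
  have hall : ∀ k, 1 ≤ v k 0 := fun k => by
    have := hT.sx.range k0 k 0
    omega
  choose f hf using hsur
  simp only at hf
  refine ⟨xx (v 0), hin _ (hv 0) (hT.sum 0) (hall 0), f, ?_, fun i => ?_⟩
  · intro a b hab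
    rw [← hf a, hab, hf b]
  · have h1 := (hlam _ (hv (f i)) (hT.sum (f i))).1 (hall _)
    rw [hf, hT.wt] at h1
    apply h1
    rw [Metric.mem_ball, dist_pi_lt_iff (hd j0)]
    intro a
    refine lt_of_le_of_lt ?_ hM
    simp only [hxx, Real.dist_eq]
    rw [← sub_div, abs_div, abs_of_pos hMp]
    gcongr
    have e1 := hT.sx.range 0 (f i) a
    have e2 := hT.sx.range (f i) 0 a
    have e1' : (v 0 a : ℝ) ≤ v (f i) a + 1 := by exact_mod_cast e1
    have e2' : (v (f i) a : ℝ) ≤ v 0 a + 1 := by exact_mod_cast e2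
    rw [abs_le]
    constructor <;> linarith

theorem open_forall {X : Type*} [TopologicalSpace X] {S : Set Plane} (hS : IsCompact S) {P : X → Plane → Prop}
    (hP : IsOpen {z : X × Plane | P z.1 z.2}) : IsOpen {x | ∀ p ∈ S, P x p} := by
  rw [isOpen_iff_mem_nhds]
  intro x hx
  exact hS.eventually_forall_of_forall_eventually fun y hy => hP.mem_nhds (hx y hy)

def PW (F : Set (Set Plane)) (n : ℕ) : Prop :=
  ∃ w : Fin 3 → Fin 3 → ℝ, (∀ i, w i ≠ 0) ∧ ∀ S ∈ F, S ⊆ Metric.closedBall 0 (n : ℝ) →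
    ∃ p ∈ S, ∃ i, w i 0 * p 0 + w i 1 * p 1 = w i 2

theorem isLine_exists (w : Fin 3 → ℝ) (hw : w ≠ 0) :
    ∃ l : Set Plane, IsLine l ∧ ∀ p : Plane, w 0 * p 0 + w 1 * p 1 = w 2 → p ∈ l := by
  by_cases h : w 0 = 0 ∧ w 1 = 0
  · refine ⟨_, ⟨0, EuclideanSpace.single 0 1, ?_, rfl⟩, fun p hp => ?_⟩
    · intro h; have := congrArg (fun v : Plane => v 0) h; simp at this
    · exfalso
      apply hw
      rw [h.1, h.2] at hp
      funext i
      fin_cases i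
      · exact h.1
      · exact h.2
      · simp only [zero_mul, add_zero] at hp; exact hp.symm
  · have hpos : w 0 ^ 2 + w 1 ^ 2 ≠ 0 := by
      intro h2
      apply h
      constructor <;> nlinarith [sq_nonneg (w 0), sq_nonneg (w 1)]
    set D := w 0 ^ 2 + w 1 ^ 2 with hD
    refine ⟨_, ⟨!₂[w 2 * w 0 / D, w 2 * w 1 / D], !₂[- w 1, w 0], ?_, rfl⟩, fun p hp => ?_⟩
    · intro h3
      apply h
      have e0 := congrArg (fun v : Plane => v 0) h3
      have e1 := congrArg (fun v : Plane => v 1) h3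
      simp at e0 e1
      exact ⟨e1, e0⟩
    · refine ⟨(w 0 * p 1 - w 1 * p 0) / D, ?_⟩
      ext i
      fin_cases i
      · simp
        field_simp
        rw [← hp, hD]; ring
      · simp
        field_simp
        rw [← hp, hD]; ring

theorem pierced_of_PW (F : Set (Set Plane)) (hc : ∀ S ∈ F, IsCompact S) (h : ∀ n, PW F n) :
    PiercedByLines F 3 := by
  set C : Set (Fin 3 → Fin 3 → ℝ) := Set.univ.pi fun _ => Metric.sphere 0 1 with hC
  have hCc : IsCompact C := isCompact_univ_pi fun _ => isCompact_sphere _ _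
  set K : ℕ → Set (Fin 3 → Fin 3 → ℝ) := fun n => C ∩ ⋂ S ∈ {S | S ∈ F ∧ S ⊆ Metric.closedBall 0 (n : ℝ)},
    {w | ∃ p ∈ S, ∃ i, w i 0 * p 0 + w i 1 * p 1 = w i 2} with hK
  have hclosed : ∀ n, IsClosed (K n) := by
    intro n
    refine hCc.isClosed.inter (isClosed_biInter fun S hS => ?_)
    rw [← isOpen_compl_iff]
    have := open_forall (X := Fin 3 → Fin 3 → ℝ) (hc S hS.1)
      (P := fun w p => ∀ i, w i 0 * p 0 + w i 1 * p 1 ≠ w i 2) (by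
        simp only [Set.ofPred_forall]
        exact isOpen_iInter_of_finite fun i => isOpen_ne_fun (by fun_prop) (by fun_prop))
    convert this using 1
    ext w
    simp
  have hne : ∀ n, (K n).Nonempty := by
    intro n
    obtain ⟨w, hw, hp⟩ := h n
    refine ⟨fun i => ‖w i‖⁻¹ • w i, ?_, ?_⟩
    · intro i _
      have : ‖w i‖ ≠ 0 := norm_ne_zero_iff.2 (hw i)
      rw [mem_sphere_zero_iff_norm, norm_smul, norm_inv, norm_norm, inv_mul_cancel₀ this]
    · refine Set.mem_iInter₂.2 fun S hS => ?_
      obtain ⟨p, hpS, i, hi⟩ := hp S hS.1 hS.2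
      refine ⟨p, hpS, i, ?_⟩
      simp only [Pi.smul_apply, smul_eq_mul]
      rw [← hi]; ring
  have hmono : ∀ n, K (n+1) ⊆ K n := by
    rintro n w ⟨h1, h2⟩
    refine ⟨h1, Set.mem_iInter₂.2 fun S hS => ?_⟩
    refine Set.mem_iInter₂.1 h2 S ⟨hS.1, hS.2.trans (Metric.closedBall_subset_closedBall ?_)⟩
    push_cast; linarith
  obtain ⟨w, hw⟩ := IsCompact.nonempty_iInter_of_sequence_nonempty_isCompact_isClosed K hmono hne
    (hCc.inter_right (by
      have := hclosed 0
      simp only [hK] at this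
      refine isClosed_biInter fun S hS => ?_
      rw [← isOpen_compl_iff]
      have := open_forall (X := Fin 3 → Fin 3 → ℝ) (hc S hS.1)
        (P := fun w p => ∀ i, w i 0 * p 0 + w i 1 * p 1 ≠ w i 2) (by
          simp only [Set.ofPred_forall]
          exact isOpen_iInter_of_finite fun i => isOpen_ne_fun (by fun_prop) (by fun_prop))
      convert this using 1
      ext w
      simp)) hclosed
  rw [Set.mem_iInter] at hw
  have hw0 : ∀ i, w i ≠ 0 := by
    intro i h0
    have := (hw 0).1 i trivial
    simp [h0] at this
  choose l hl hlw using fun i => isLine_exists (w i) (hw0 i)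
  refine ⟨l, hl, fun S hS => ?_⟩
  obtain ⟨r, hr⟩ := (hc S hS).isBounded.subset_closedBall 0
  obtain ⟨n, hn⟩ := exists_nat_ge r
  obtain ⟨p, hp, i, hi⟩ := Set.mem_iInter₂.1 (hw n).2 S ⟨hS, hr.trans (Metric.closedBall_subset_closedBall hn)⟩
  exact ⟨p, hp, Set.mem_iUnion.2 ⟨i, hlw i p hi⟩⟩

noncomputable def ga (R : ℝ) (x : I6 → ℝ) (p : Plane) : ℝ := LL R 0 (2 * Real.pi * (x 0 + x 1 + x 2)) p
noncomputable def gb (R : ℝ) (x : I6 → ℝ) (p : Plane) : ℝ :=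
  - LL R (2 * Real.pi * x 0) (2 * Real.pi * (x 0 + x 1 + x 2 + x 3)) p
noncomputable def gc (R : ℝ) (x : I6 → ℝ) (p : Plane) : ℝ :=
  LL R (2 * Real.pi * (x 0 + x 1)) (2 * Real.pi * (x 0 + x 1 + x 2 + x 3 + x 4)) p

theorem ga_cont (R) : Continuous fun z : (I6 → ℝ) × Plane => ga R z.1 z.2 := by
  unfold ga LL; fun_prop
theorem gb_cont (R) : Continuous fun z : (I6 → ℝ) × Plane => gb R z.1 z.2 := by
  unfold gb LL; fun_prop
theorem gc_cont (R) : Continuous fun z : (I6 → ℝ) × Plane => gc R z.1 z.2 := by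
  unfold gc LL; fun_prop

def EC (a b c : ℝ) (i : I6) : Prop :=
  (i = 0 ∧ 0 < a ∧ 0 < b) ∨ (i = 1 ∧ b < 0 ∧ c < 0) ∨ (i = 2 ∧ 0 < a ∧ 0 < c) ∨
  (i = 3 ∧ a < 0 ∧ b < 0) ∨ (i = 4 ∧ 0 < b ∧ 0 < c) ∨ (i = 5 ∧ a < 0 ∧ c < 0)

theorem EC0 {a b c : ℝ} : EC a b c 0 ↔ 0 < a ∧ 0 < b := by
  unfold EC; constructor
  · rintro (h | h | h | h | h | h)
    · exact h.2
    all_goals exact absurd h.1 (by decide)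
  · intro h; simp [h]
theorem EC1 {a b c : ℝ} : EC a b c 1 ↔ b < 0 ∧ c < 0 := by
  unfold EC; constructor
  · rintro (h | h | h | h | h | h)
    on_goal 2 => exact h.2
    all_goals exact absurd h.1 (by decide)
  · intro h; simp [h]
theorem EC2 {a b c : ℝ} : EC a b c 2 ↔ 0 < a ∧ 0 < c := by
  unfold EC; constructor
  · rintro (h | h | h | h | h | h)
    on_goal 3 => exact h.2
    all_goals exact absurd h.1 (by decide)
  · intro h; simp [h]
theorem EC3 {a b c : ℝ} : EC a b c 3 ↔ a < 0 ∧ b < 0 := by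
  unfold EC; constructor
  · rintro (h | h | h | h | h | h)
    on_goal 4 => exact h.2
    all_goals exact absurd h.1 (by decide)
  · intro h; simp [h]
theorem EC4 {a b c : ℝ} : EC a b c 4 ↔ 0 < b ∧ 0 < c := by
  unfold EC; constructor
  · rintro (h | h | h | h | h | h)
    on_goal 5 => exact h.2
    all_goals exact absurd h.1 (by decide)
  · intro h; simp [h]
theorem EC5 {a b c : ℝ} : EC a b c 5 ↔ a < 0 ∧ c < 0 := by
  unfold EC; constructor
  · rintro (h | h | h | h | h | h)
    on_goal 6 => exact h.2
    all_goals exact absurd h.1 (by decide)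
  · intro h; simp [h]

theorem EC_open (R : ℝ) (i : I6) :
    IsOpen {z : (I6 → ℝ) × Plane | EC (ga R z.1 z.2) (gb R z.1 z.2) (gc R z.1 z.2) i} := by
  have a1 := isOpen_lt continuous_const (ga_cont R) (f := fun _ => 0)
  have b1 := isOpen_lt continuous_const (gb_cont R) (f := fun _ => 0)
  have c1 := isOpen_lt continuous_const (gc_cont R) (f := fun _ => 0)
  have a2 := isOpen_lt (ga_cont R) continuous_const (g := fun _ => 0)
  have b2 := isOpen_lt (gb_cont R) continuous_const (g := fun _ => 0)
  have c2 := isOpen_lt (gc_cont R) continuous_const (g := fun _ => 0)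
  rcases cases6 i with rfl | rfl | rfl | rfl | rfl | rfl
  · simp only [EC0]; exact a1.and b1
  · simp only [EC1]; exact b2.and c2
  · simp only [EC2]; exact a1.and c1
  · simp only [EC3]; exact a2.and b2
  · simp only [EC4]; exact b1.and c1
  · simp only [EC5]; exact a2.and c2

theorem EC_bd {R : ℝ} (hR : 0 ≤ R) {x : I6 → ℝ} (hx : x ∈ stdSimplex ℝ I6) {i : I6} (hi : x i = 0) {p : Plane}
    (hp : ‖p‖ ≤ R) (h : EC (ga R x p) (gb R x p) (gc R x p) i) : False := by
  obtain ⟨hx, hs⟩ := hx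
  have hs : x 0 + x 1 + x 2 + x 3 + x 4 + x 5 = 1 := (Fin.sum_univ_six x).symm.trans hs
  have h0 := hx 0
  have h1 := hx 1
  have h2 := hx 2
  have h3 := hx 3
  have h4 := hx 4
  have h5 := hx 5
  have hpi := Real.pi_pos
  have A1 : LL R (2 * Real.pi * (x 0 + x 1 + x 2)) (0 + 2 * Real.pi) p = _ := LL_anti _ _ _ _
  have A2 := LL_anti R (2 * Real.pi * x 0) (2 * Real.pi * (x 0 + x 1 + x 2 + x 3)) p
  have A3 := LL_anti R (2 * Real.pi * (x 0 + x 1)) (2 * Real.pi * (x 0 + x 1 + x 2 + x 3 + x 4)) p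
  have A4 := LL_anti R 0 (2 * Real.pi * (x 0 + x 1)) p
  unfold ga gb gc at h
  rcases cases6 i with rfl | rfl | rfl | rfl | rfl | rfl
  · rw [EC0, hi] at h
    have := LL_mono hR hp (by positivity) (t' := 2 * Real.pi * (0 + x 1 + x 2 + x 3)) (by nlinarith) (by nlinarith) h.1
    rw [mul_zero] at h
    linarith
  · rw [EC1, hi] at h
    have := LL_mono hR hp (s := 2 * Real.pi * x 0) (t := 2 * Real.pi * (x 0 + 0 + x 2 + x 3)) (t' := 2 * Real.pi * (x 0 + 0 + x 2 + x 3 + x 4)) (by nlinarith) (by nlinarith) (by nlinarith) (by linarith)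
    rw [add_zero] at h this
    linarith
  · rw [EC2] at h
    rw [hi] at h A1
    rw [add_zero] at *
    have := LL_mono hR hp (t' := 0 + 2 * Real.pi) (by nlinarith) (by nlinarith) (by nlinarith) h.2
    linarith
  · rw [EC3] at h
    rw [hi, add_zero] at h A2
    have := LL_mono hR hp (s := 2 * Real.pi * (x 0 + x 1 + x 2)) (t := 0 + 2 * Real.pi) (t' := 2 * Real.pi * x 0 + 2 * Real.pi) (by nlinarith) (by nlinarith) (by nlinarith) (by linarith)
    linarith
  · rw [EC4] at h
    rw [hi, add_zero] at h A3
    have := LL_mono hR hp (s := 2 * Real.pi * (x 0 + x 1 + x 2 + x 3)) (t := 2 * Real.pi * x 0 + 2 * Real.pi) (t' := 2 * Real.pi * (x 0 + x 1) + 2 * Real.pi) (by nlinarith) (by nlinarith) (by nlinarith) (by linarith)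
    linarith
  · rw [EC5] at h
    have e : 2 * Real.pi * (x 0 + x 1 + x 2 + x 3 + x 4) = 0 + 2 * Real.pi := by
      rw [show x 0 + x 1 + x 2 + x 3 + x 4 = 1 by linarith]; ring
    rw [e] at h
    have := LL_mono hR hp (s := 0) (t := 2 * Real.pi * (x 0 + x 1)) (t' := 2 * Real.pi * (x 0 + x 1 + x 2)) (by positivity) (by nlinarith) (by nlinarith) (by linarith)
    linarith

theorem const_sign {S : Set Plane} (hS : IsPreconnected S) {g : Plane → ℝ} (hg : Continuous g)
    (h0 : ∀ p ∈ S, g p ≠ 0) : (∀ p ∈ S, 0 < g p) ∨ (∀ p ∈ S, g p < 0) := by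
  by_contra hcon
  push Not at hcon
  obtain ⟨⟨p, hp, hp0⟩, ⟨q, hq, hq0⟩⟩ := hcon
  obtain ⟨r, hr, hr0⟩ := hS.intermediate_value hp hq hg.continuousOn ⟨hp0, hq0⟩
  exact h0 r hr hr0

theorem tight_pos {A B C : Set Plane} (h : Tight A B C) {f g k : Plane → ℝ}
    (hf : Convex ℝ {p | 0 < f p}) (hg : Convex ℝ {p | 0 < g p}) (hk : Convex ℝ {p | 0 < k p})
    (hA : ∀ p ∈ A, 0 < f p ∧ 0 < g p) (hB : ∀ p ∈ B, 0 < f p ∧ 0 < k p) (hC : ∀ p ∈ C, 0 < g p ∧ 0 < k p) :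
    ∃ p, 0 < f p ∧ 0 < g p ∧ 0 < k p := by
  obtain ⟨p, ⟨h1, h2⟩, h3⟩ := h
  refine ⟨p, ?_, ?_, ?_⟩
  · exact convexHull_min (by rintro x (h | h); exacts [(hA x h).1, (hB x h).1]) hf h1
  · exact convexHull_min (by rintro x (h | h); exacts [(hA x h).2, (hC x h).1]) hg h2
  · exact convexHull_min (by rintro x (h | h); exacts [(hB x h).2, (hC x h).2]) hk h3

theorem LL_convex (R s t : ℝ) : Convex ℝ {p : Plane | 0 < LL R s t p} := by
  intro p hp q hq a b ha hb hab
  simp only [Set.mem_ofPred_eq] at *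
  have : LL R s t (a • p + b • q) = a * LL R s t p + b * LL R s t q := by
    unfold LL; simp only [PiLp.add_apply, PiLp.smul_apply, smul_eq_mul]
    linear_combination (R * Real.cos ((t-s)/2)) * hab
  rw [this]
  rcases ha.eq_or_lt with rfl | ha
  · have : b = 1 := by linarith
    subst this; linarith
  · have := mul_pos ha hp
    have := mul_nonneg hb hq.le
    linarith

theorem LL_convex' (R s t : ℝ) : Convex ℝ {p : Plane | 0 < - LL R s t p} := by
  simp only [← LL_anti]; exact LL_convex _ _ _

theorem Tight.swap12 {A B C} (h : Tight A B C) : Tight B A C := by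
  obtain ⟨p, ⟨h1, h2⟩, h3⟩ := h
  exact ⟨p, ⟨by rwa [Set.union_comm], h3⟩, h2⟩
theorem Tight.swap23 {A B C} (h : Tight A B C) : Tight A C B := by
  obtain ⟨p, ⟨h1, h2⟩, h3⟩ := h
  exact ⟨p, ⟨h2, h1⟩, by rwa [Set.union_comm]⟩

theorem tight_all (F : Fin 6 → Set (Set Plane))
    (htight : ∀ i₁ i₂ i₃ : Fin 6, i₁ < i₂ → i₂ < i₃ →
      ∀ A₁ ∈ F i₁, ∀ A₂ ∈ F i₂, ∀ A₃ ∈ F i₃, Tight A₁ A₂ A₃) (i j k : Fin 6) (hij : i ≠ j) (hik : i ≠ k)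
      (hjk : j ≠ k) {A B C} (hA : A ∈ F i) (hB : B ∈ F j) (hC : C ∈ F k) : Tight A B C := by
  rcases lt_or_gt_of_ne hij with h1 | h1 <;> rcases lt_or_gt_of_ne hik with h2 | h2 <;>
    rcases lt_or_gt_of_ne hjk with h3 | h3
  · exact htight i j k h1 h3 _ hA _ hB _ hC
  · exact (htight i k j h2 h3 _ hA _ hC _ hB).swap23
  · exact absurd (h1.trans h3) (not_lt.2 h2.le)
  · exact (htight k i j h2 h1 _ hC _ hA _ hB).swap12.swap23
  · exact (htight j i k h1 h2 _ hB _ hA _ hC).swap12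
  · exact absurd (h1.trans h2) (not_lt.2 h3.le)
  · exact (htight j k i h3 h2 _ hB _ hC _ hA).swap23.swap12
  · exact (htight k j i h3 h1 _ hC _ hB _ hA).swap12.swap23.swap12

theorem stmt_0 (F : Fin 6 → Set (Set Plane))
    (hne : ∀ j, ∀ S ∈ F j, S.Nonempty)
    (hcpt : ∀ j, ∀ S ∈ F j, IsCompact S)
    (hconn : ∀ j, ∀ S ∈ F j, IsConnected S)
    (htight : ∀ i₁ i₂ i₃ : Fin 6, i₁ < i₂ → i₂ < i₃ →
      ∀ A₁ ∈ F i₁, ∀ A₂ ∈ F i₂, ∀ A₃ ∈ F i₃, Tight A₁ A₂ A₃) :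
    ∃ i : Fin 6, PiercedByLines (F i) 3 := by
  by_contra hcon
  push Not at hcon
  have hn : ∀ j, ∃ n, ¬ PW (F j) n := by
    intro j
    by_contra h
    push Not at h
    exact hcon j (pierced_of_PW (F j) (hcpt j) h)
  choose n hn using hn
  obtain ⟨j0, hj0⟩ := Finite.exists_max n
  obtain ⟨R, hR⟩ : ∃ R : ℝ, R = ((n j0 : ℕ) : ℝ) := ⟨_, rfl⟩
  have hR0 : 0 ≤ R := by rw [hR]; exact Nat.cast_nonneg _
  obtain ⟨x, hx, f, hf, hA⟩ := ckkm (fun j i => ⋃ S ∈ {S | S ∈ F j ∧ S ⊆ Metric.closedBall 0 R},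
      {x | ∀ p ∈ S, EC (ga R x p) (gb R x p) (gc R x p) i})
    (fun j i => isOpen_biUnion fun S hS => open_forall (hcpt j S hS.1) (EC_open R i))
    (by
      intro j x hx
      have h1 := hn j
      unfold PW at h1
      push Not at h1
      obtain ⟨S, hS, hSn, h2⟩ := h1 ![
        ![Real.cos ((0 + 2 * Real.pi * (x 0 + x 1 + x 2))/2), Real.sin ((0 + 2 * Real.pi * (x 0 + x 1 + x 2))/2), R * Real.cos ((2 * Real.pi * (x 0 + x 1 + x 2) - 0)/2)],
        ![Real.cos ((2 * Real.pi * x 0 + 2 * Real.pi * (x 0 + x 1 + x 2 + x 3))/2), Real.sin ((2 * Real.pi * x 0 + 2 * Real.pi * (x 0 + x 1 + x 2 + x 3))/2), R * Real.cos ((2 * Real.pi * (x 0 + x 1 + x 2 + x 3) - 2 * Real.pi * x 0)/2)],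
        ![Real.cos ((2 * Real.pi * (x 0 + x 1) + 2 * Real.pi * (x 0 + x 1 + x 2 + x 3 + x 4))/2), Real.sin ((2 * Real.pi * (x 0 + x 1) + 2 * Real.pi * (x 0 + x 1 + x 2 + x 3 + x 4))/2), R * Real.cos ((2 * Real.pi * (x 0 + x 1 + x 2 + x 3 + x 4) - 2 * Real.pi * (x 0 + x 1))/2)]] (by
          have key : ∀ a r : ℝ, ![Real.cos a, Real.sin a, r] ≠ 0 := by
            intro a r h
            have e0 := congrFun h 0
            have e1 := congrFun h 1
            simp only [Matrix.cons_val_zero, Matrix.cons_val_one, Pi.zero_apply] at e0 e1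
            have := Real.sin_sq_add_cos_sq a
            rw [e0, e1] at this
            norm_num at this
          intro i
          fin_cases i
          · exact key _ _
          · exact key _ _
          · exact key _ _)
      have ha : ∀ p ∈ S, ga R x p ≠ 0 := by
        intro p hp h
        refine h2 p hp 0 ?_
        simp only [ga, LL] at h
        simp only [Matrix.cons_val_zero, Matrix.cons_val_one, Matrix.cons_val]
        linarith
      have hb : ∀ p ∈ S, gb R x p ≠ 0 := by
        intro p hp h
        refine h2 p hp 1 ?_
        simp only [gb, LL] at h
        simp only [Matrix.cons_val_zero, Matrix.cons_val_one, Matrix.cons_val]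
        linarith
      have hc : ∀ p ∈ S, gc R x p ≠ 0 := by
        intro p hp h
        refine h2 p hp 2 ?_
        simp only [gc, LL] at h
        simp only [Matrix.cons_val_zero, Matrix.cons_val_one, Matrix.cons_val]
        linarith
      have hpc := (hconn j S hS).isPreconnected
      have hSR : S ∈ {S | S ∈ F j ∧ S ⊆ Metric.closedBall 0 R} := ⟨hS, hSn.trans
        (Metric.closedBall_subset_closedBall (by rw [hR]; exact_mod_cast hj0 j))⟩
      suffices h : ∃ i, ∀ p ∈ S, EC (ga R x p) (gb R x p) (gc R x p) i by
        obtain ⟨i, hi⟩ := h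
        exact ⟨i, Set.mem_biUnion hSR hi⟩
      have ca := const_sign hpc ((ga_cont R).comp (Continuous.prodMk_right x)) ha
      have cb := const_sign hpc ((gb_cont R).comp (Continuous.prodMk_right x)) hb
      have cc := const_sign hpc ((gc_cont R).comp (Continuous.prodMk_right x)) hc
      rcases ca with ca | ca <;> rcases cb with cb | cb <;> rcases cc with cc | cc
      · exact ⟨0, fun p hp => EC0.2 ⟨ca p hp, cb p hp⟩⟩
      · exact ⟨0, fun p hp => EC0.2 ⟨ca p hp, cb p hp⟩⟩
      · exact ⟨2, fun p hp => EC2.2 ⟨ca p hp, cc p hp⟩⟩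
      · exact ⟨1, fun p hp => EC1.2 ⟨cb p hp, cc p hp⟩⟩
      · exact ⟨4, fun p hp => EC4.2 ⟨cb p hp, cc p hp⟩⟩
      · exact ⟨5, fun p hp => EC5.2 ⟨ca p hp, cc p hp⟩⟩
      · exact ⟨3, fun p hp => EC3.2 ⟨ca p hp, cb p hp⟩⟩
      · exact ⟨3, fun p hp => EC3.2 ⟨ca p hp, cb p hp⟩⟩)
    (by
      intro j i x hx hi hxA
      obtain ⟨S, hS, hxS⟩ := Set.mem_iUnion₂.1 hxA
      obtain ⟨p, hp⟩ := hne j S hS.1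
      exact EC_bd hR0 hx hi (by simpa using hS.2 hp) (hxS p hp))
  have hA' : ∀ i, ∃ S ∈ F (f i), ∀ p ∈ S, EC (ga R x p) (gb R x p) (gc R x p) i := by
    intro i
    obtain ⟨S, hS, hxS⟩ := Set.mem_iUnion₂.1 (hA i)
    exact ⟨S, hS.1, hxS⟩
  choose S hS hE using hA'
  have T1 : Tight (S 0) (S 2) (S 4) := tight_all F htight (f 0) (f 2) (f 4)
    (hf.ne (by decide)) (hf.ne (by decide)) (hf.ne (by decide)) (hS 0) (hS 2) (hS 4)
  have T2 : Tight (S 1) (S 3) (S 5) := tight_all F htight (f 1) (f 3) (f 5)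
    (hf.ne (by decide)) (hf.ne (by decide)) (hf.ne (by decide)) (hS 1) (hS 3) (hS 5)
  obtain ⟨p, p1, p2, p3⟩ := tight_pos T1 (f := ga R x) (g := gb R x) (k := gc R x)
    (LL_convex _ _ _) (LL_convex' _ _ _) (LL_convex _ _ _)
    (fun p hp => EC0.1 (hE 0 p hp)) (fun p hp => EC2.1 (hE 2 p hp)) (fun p hp => EC4.1 (hE 4 p hp))
  obtain ⟨q, q1, q2, q3⟩ := tight_pos T2 (f := fun p => - gb R x p) (g := fun p => - gc R x p) (k := fun p => - ga R x p)
    (by simp only [gb, neg_neg]; exact LL_convex _ _ _) (LL_convex' _ _ _) (LL_convex' _ _ _)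
    (fun p hp => by have := EC1.1 (hE 1 p hp); constructor <;> linarith)
    (fun p hp => by have := EC3.1 (hE 3 p hp); constructor <;> linarith)
    (fun p hp => by have := EC5.1 (hE 5 p hp); constructor <;> linarith)
  unfold ga at p1 q3
  unfold gb at p2 q1
  unfold gc at p3 q2
  obtain ⟨hx, hs⟩ := hx
  have hs : x 0 + x 1 + x 2 + x 3 + x 4 + x 5 = 1 := (Fin.sum_univ_six x).symm.trans hs
  have h0 := hx 0
  have h1 := hx 1
  have h2 := hx 2
  have h3 := hx 3
  have h4 := hx 4
  have h5 := hx 5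
  have hpi := Real.pi_pos
  refine LL_final (R := R) (p := p) (q := q) (t0 := 0) (t1 := 2 * Real.pi * x 0) (t2 := 2 * Real.pi * (x 0 + x 1))
    (t3 := 2 * Real.pi * (x 0 + x 1 + x 2)) (t4 := 2 * Real.pi * (x 0 + x 1 + x 2 + x 3))
    (t5 := 2 * Real.pi * (x 0 + x 1 + x 2 + x 3 + x 4)) ?_ ?_ ?_ ?_ ?_ ?_ p1 ?_ p3 ?_ ?_ ?_
  · positivity
  all_goals first | linarith | nlinarith
end

section
/- Let F be a family of nonempty compact connected sets in ℝ² such that every three members of F form a tight triple. Then F is pierced by 3 lines. -/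
open Set

set_option linter.unusedSectionVars false

namespace Scarf

variable {X I α : Type*} [Fintype X] [DecidableEq X] [Fintype I] [DecidableEq I] [LinearOrder α]

def Dom (u : I → X → α) (R : Finset X) : Prop := ∀ y, ∃ i, ∀ x ∈ R, u i y ≤ u i x

def Above (u : I → X → α) (mn : I → X) (k : I) (y : X) : Prop := ∀ l, l ≠ k → u l (mn l) < u l y

def Top (u : I → X → α) (mn : I → X) (k : I) (z : X) : Prop :=
  Above u mn k z ∧ ∀ y, Above u mn k y → u k y ≤ u k z

theorem Dom.mono {u : I → X → α} {R S : Finset X} (h : Dom u R) (hs : S ⊆ R) : Dom u S := by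
  intro y
  obtain ⟨i, hi⟩ := h y
  exact ⟨i, fun x hx => hi x (hs hx)⟩

theorem exists_mn (u : I → X → α) {D : Finset X} (hD : D.Nonempty) :
    ∃ mn : I → X, ∀ i, mn i ∈ D ∧ ∀ x ∈ D, u i (mn i) ≤ u i x := by
  have : ∀ i, ∃ y, y ∈ D ∧ ∀ x ∈ D, u i y ≤ u i x := fun i => by
    obtain ⟨y, hy, h⟩ := D.exists_min_image (u i) hD
    exact ⟨y, hy, h⟩
  choose mn h using this
  exact ⟨mn, h⟩

/-- surjectivity of the min map for a dominating set -/
theorem image_mn {u : I → X → α} (hu : ∀ i, Function.Injective (u i)) {D : Finset X} (hD : Dom u D)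
    {mn : I → X} (hmn : ∀ i, mn i ∈ D ∧ ∀ x ∈ D, u i (mn i) ≤ u i x) :
    Finset.univ.image mn = D := by
  ext y
  simp only [Finset.mem_image, Finset.mem_univ, true_and]
  constructor
  · rintro ⟨i, rfl⟩; exact (hmn i).1
  · intro hy
    obtain ⟨i, hi⟩ := hD y
    exact ⟨i, hu i (le_antisymm ((hmn i).2 y hy) (hi _ (hmn i).1))⟩

theorem top_spec {u : I → X → α} {D : Finset X} (hD : Dom u D)
    {mn : I → X} (hmn : ∀ i, mn i ∈ D ∧ ∀ x ∈ D, u i (mn i) ≤ u i x) {k : I}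
    (hk : ∀ y ∈ D, ∃ l, l ≠ k ∧ mn l = y) {z : X} (hz : Top u mn k z) :
    z ∉ D ∧ (∀ x ∈ D, u k z ≤ u k x) ∧ Dom u (insert z D) := by
  have h1 : z ∉ D := by
    intro hzD
    obtain ⟨l, hl, rfl⟩ := hk z hzD
    exact lt_irrefl _ (hz.1 l hl)
  have h2 : ∀ x ∈ D, u k z ≤ u k x := by
    obtain ⟨l, hl⟩ := hD z
    by_cases h : l = k
    · subst h; exact hl
    · exact absurd (hz.1 l h) (not_lt.2 (hl _ (hmn l).1))
  refine ⟨h1, h2, fun y => ?_⟩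
  by_cases hy : Above u mn k y
  · refine ⟨k, fun x hx => ?_⟩
    rcases Finset.mem_insert.1 hx with rfl | hx
    · exact hz.2 y hy
    · exact (hz.2 y hy).trans (h2 x hx)
  · unfold Above at hy
    push Not at hy
    obtain ⟨l, hl, hle⟩ := hy
    refine ⟨l, fun x hx => ?_⟩
    rcases Finset.mem_insert.1 hx with rfl | hx
    · exact hle.trans (hz.1 l hl).le
    · exact hle.trans ((hmn l).2 x hx)

theorem door {u : I → X → α} (hu : ∀ i, Function.Injective (u i)) {D : Finset X} (hD : Dom u D)
    (hc : D.card + 1 = Fintype.card I)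
    {mn : I → X} (hmn : ∀ i, mn i ∈ D ∧ ∀ x ∈ D, u i (mn i) ≤ u i x) {i j : I} (hij : i ≠ j)
    (heq : mn i = mn j) :
    (∀ z, Top u mn i z ∨ Top u mn j z → z ∉ D ∧ Dom u (insert z D)) ∧
    (∀ z, z ∉ D → Dom u (insert z D) → Top u mn i z ∨ Top u mn j z) ∧
    (∀ z, Top u mn i z → ¬ Top u mn j z) := by
  have him := image_mn hu hD hmn
  have hki : ∀ y ∈ D, ∃ l, l ≠ i ∧ mn l = y := by
    intro y hy
    rw [← him] at hy
    obtain ⟨l, -, rfl⟩ := Finset.mem_image.1 hy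
    by_cases h : l = i
    · subst h; exact ⟨j, hij.symm, heq.symm⟩
    · exact ⟨l, h, rfl⟩
  have hkj : ∀ y ∈ D, ∃ l, l ≠ j ∧ mn l = y := by
    intro y hy
    rw [← him] at hy
    obtain ⟨l, -, rfl⟩ := Finset.mem_image.1 hy
    by_cases h : l = j
    · subst h; exact ⟨i, hij, heq⟩
    · exact ⟨l, h, rfl⟩
  refine ⟨?_, ?_, ?_⟩
  · rintro z (h | h)
    · exact ⟨(top_spec hD hmn hki h).1, (top_spec hD hmn hki h).2.2⟩
    · exact ⟨(top_spec hD hmn hkj h).1, (top_spec hD hmn hkj h).2.2⟩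
  · intro z hz hdom
    obtain ⟨mr, hmr⟩ := exists_mn u (Finset.insert_nonempty z D)
    have himr := image_mn hu hdom hmr
    have hinj : Function.Injective mr := by
      have : (Finset.univ.image mr).card = (Finset.univ : Finset I).card := by
        rw [himr, Finset.card_insert_of_notMem hz, hc, Finset.card_univ]
      intro a b hab
      exact Finset.card_image_iff.1 this (by simp) (by simp) hab
    obtain ⟨k, hk⟩ : ∃ k, mr k = z := by
      have : z ∈ Finset.univ.image mr := by rw [himr]; simp
      simpa using this
    have hother : ∀ l, l ≠ k → mr l = mn l := by
      intro l hl
      have h1 : mr l ≠ z := fun h => hl (hinj (h.trans hk.symm))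
      have h2 : mr l ∈ D := by
        have := (hmr l).1
        rcases Finset.mem_insert.1 this with h | h
        · exact absurd h h1
        · exact h
      exact hu l (le_antisymm ((hmr l).2 _ (Finset.mem_insert_of_mem (hmn l).1)) ((hmn l).2 _ h2))
    have hab : Above u mn k z := by
      intro l hl
      rw [← hother l hl]
      refine lt_of_le_of_ne ((hmr l).2 z (Finset.mem_insert_self _ _)) ?_
      intro h
      exact hl (hinj ((hu l h).trans hk.symm))
    have htop : Top u mn k z := by
      refine ⟨hab, fun y hy => ?_⟩
      obtain ⟨l, hl⟩ := hdom y
      by_cases h : l = k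
      · subst h; exact hl z (Finset.mem_insert_self _ _)
      · exact absurd (hy l h) (not_lt.2 (hl _ (Finset.mem_insert_of_mem (hmn l).1)))
    by_cases h1 : k = i
    · subst h1; exact Or.inl htop
    by_cases h2 : k = j
    · subst h2; exact Or.inr htop
    exfalso
    apply hij
    apply hinj
    rw [hother i (Ne.symm h1), hother j (Ne.symm h2), heq]
  · intro z h1 h2
    have := h1.1 j hij.symm
    exact absurd this (not_lt.2 ((top_spec hD hmn hkj h2).2.1 _ (hmn j).1))

theorem exists_top {u : I → X → α} {mn : I → X} {k : I} (h : ∃ y, Above u mn k y) :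
    ∃ z, Top u mn k z := by
  classical
  obtain ⟨y, hy⟩ := h
  obtain ⟨z, hz, hz'⟩ := (Finset.univ.filter (Above u mn k)).exists_max_image (u k)
    ⟨y, by simpa using hy⟩
  refine ⟨z, by simpa using hz, fun y hy => hz' y (by simpa using hy)⟩

theorem top_unique {u : I → X → α} (hu : ∀ i, Function.Injective (u i)) {mn : I → X} {k : I}
    {z z' : X} (h : Top u mn k z) (h' : Top u mn k z') : z = z' :=
  hu k (le_antisymm (h'.2 _ h.1) (h.2 _ h'.1))

theorem scarf {u : I → X → α} (hu : ∀ i, Function.Injective (u i)) (hI : 2 ≤ Fintype.card I)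
    (s : I → X) (hs1 : ∀ i y, u i (s i) ≤ u i y)
    (hs2 : ∀ i j, i ≠ j → ∀ y, y ∉ Set.range s → u i y < u i (s j))
    (t0 : X) (ht0 : t0 ∉ Set.range s) (c : X → I) (hcs : ∀ i, c (s i) = i) :
    ∃ R : Finset X, Dom u R ∧ R.image c = Finset.univ := by
  classical
  by_contra hno
  push Not at hno
  have hsinj : Function.Injective s := fun a b h => by rw [← hcs a, h, hcs]
  obtain ⟨i0⟩ : Nonempty I := Fintype.card_pos_iff.1 (by omega)
  let Rs : Finset (Finset X) := Finset.univ.filter fun R => Dom u R ∧ R.card = Fintype.card I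
  let Ds : Finset (Finset X) := Finset.univ.filter fun D => Dom u D ∧ D.card + 1 = Fintype.card I ∧
    D.image c = Finset.univ.erase i0
  let D0 : Finset X := (Finset.univ.erase i0).image s
  have hsum := Finset.sum_card_bipartiteAbove_eq_sum_card_bipartiteBelow (s := Ds) (t := Rs)
    (fun D R => D ⊆ R)
  -- room side
  have hroom : ∀ R ∈ Rs, Even (Finset.bipartiteBelow (fun D R => D ⊆ R) Ds R).card := by
    intro R hR
    simp only [Rs, Finset.mem_filter, Finset.mem_univ, true_and] at hR
    obtain ⟨hRd, hRc⟩ := hR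
    rcases Finset.eq_empty_or_nonempty (Finset.bipartiteBelow (fun D R => D ⊆ R) Ds R) with h | h
    · rw [h]; simp
    obtain ⟨D, hD⟩ := h
    simp only [Finset.bipartiteBelow, Ds, Finset.mem_filter, Finset.mem_univ, true_and] at hD
    obtain ⟨⟨-, hDc, hDi⟩, hDR⟩ := hD
    have hinjD : ∀ D : Finset X, D.card + 1 = Fintype.card I → D.image c = Finset.univ.erase i0 →
        Set.InjOn c D := by
      intro D hDc hDi
      apply Finset.card_image_iff.1
      rw [hDi, Finset.card_erase_of_mem (Finset.mem_univ _), Finset.card_univ]; omega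
    have ex : ∀ D : Finset X, D.card + 1 = Fintype.card I → D ⊆ R →
        ∃ x ∈ R, x ∉ D ∧ D = R.erase x := by
      intro D hDc hDR
      have h1 : (R \ D).card = 1 := by
        have := Finset.card_sdiff_add_card_eq_card hDR
        omega
      obtain ⟨x, hx⟩ := Finset.card_eq_one.1 h1
      have hx' : x ∈ R \ D := by rw [hx]; simp
      rw [Finset.mem_sdiff] at hx'
      refine ⟨x, hx'.1, hx'.2, ?_⟩
      rw [← Finset.sdiff_singleton_eq_erase, ← hx, Finset.sdiff_sdiff_eq_self hDR]
    obtain ⟨x, hxR, hxD, hDx⟩ := ex D hDc hDR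
    have hRx : R = insert x D := by rw [hDx, Finset.insert_erase hxR]
    have hcx : c x ≠ i0 := by
      intro h
      apply hno R hRd
      rw [hRx, Finset.image_insert, hDi, h, Finset.insert_erase (Finset.mem_univ _)]
    obtain ⟨x', hx'D, hx'⟩ : ∃ x' ∈ D, c x' = c x := by
      have : c x ∈ D.image c := by rw [hDi]; simp [hcx]
      simpa using this
    have hne : x ≠ x' := fun h => hxD (h ▸ hx'D)
    have hx'R : x' ∈ R := hDR hx'D
    have : Finset.bipartiteBelow (fun D R => D ⊆ R) Ds R = {R.erase x, R.erase x'} := by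
      ext E
      simp only [Finset.bipartiteBelow, Ds, Finset.mem_filter, Finset.mem_univ, true_and,
        Finset.mem_insert, Finset.mem_singleton]
      constructor
      · rintro ⟨⟨-, hEc, hEi⟩, hER⟩
        obtain ⟨y, hyR, hyE, hEy⟩ := ex E hEc hER
        by_cases h1 : y = x
        · left; rw [hEy, h1]
        by_cases h2 : y = x'
        · right; rw [hEy, h2]
        exfalso
        apply hne
        apply hinjD E hEc hEi _ _ hx'.symm
        · simp [hEy, hxR, Ne.symm h1]
        · simp [hEy, hx'R, Ne.symm h2]
      · rintro (rfl | rfl)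
        · refine ⟨⟨hRd.mono (Finset.erase_subset _ _), ?_, ?_⟩, Finset.erase_subset _ _⟩
          · rw [Finset.card_erase_of_mem hxR]; omega
          · rw [← hDx, hDi]
        · refine ⟨⟨hRd.mono (Finset.erase_subset _ _), ?_, ?_⟩, Finset.erase_subset _ _⟩
          · rw [Finset.card_erase_of_mem hx'R]; omega
          · rw [← hDi]
            ext k
            simp only [Finset.mem_image, hRx, Finset.mem_erase, Finset.mem_insert]
            constructor
            · rintro ⟨y, ⟨hy, rfl | hyD⟩, rfl⟩
              · exact ⟨x', hx'D, hx'⟩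
              · exact ⟨y, hyD, rfl⟩
            · rintro ⟨y, hyD, rfl⟩
              by_cases h : y = x'
              · subst h; exact ⟨x, ⟨hne, Or.inl rfl⟩, hx'.symm⟩
              · exact ⟨y, ⟨h, Or.inr hyD⟩, rfl⟩
    rw [this, Finset.card_pair]
    · exact even_two
    · intro h
      have : x ∈ R.erase x' := by simp [hne, hxR]
      rw [← h] at this
      simp at this
  -- door side
  have key : ∀ D : Finset X, Dom u D → D.card + 1 = Fintype.card I → ∀ mn : I → X,
      (∀ i, mn i ∈ D ∧ ∀ x ∈ D, u i (mn i) ≤ u i x) → ∀ i j : I, i ≠ j → mn i = mn j →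
      (Finset.bipartiteAbove (fun D R => D ⊆ R) Rs D).card =
        (Finset.univ.filter fun z => Top u mn i z ∨ Top u mn j z).card := by
    intro D hD hDc mn hmn i j hij heq
    obtain ⟨k1, k2, k3⟩ := door hu hD hDc hmn hij heq
    symm
    apply Finset.card_bij (fun z _ => insert z D)
    · intro z hz
      simp only [Finset.mem_filter, Finset.mem_univ, true_and] at hz
      simp only [Finset.bipartiteAbove, Rs, Finset.mem_filter, Finset.mem_univ, true_and]
      refine ⟨⟨(k1 z hz).2, ?_⟩, Finset.subset_insert _ _⟩
      rw [Finset.card_insert_of_notMem (k1 z hz).1, hDc]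
    · intro z hz z' hz' h
      simp only [Finset.mem_filter, Finset.mem_univ, true_and] at hz hz'
      have : z ∈ insert z' D := by rw [← h]; simp
      rcases Finset.mem_insert.1 this with h | h
      · exact h
      · exact absurd h (k1 z hz).1
    · intro R hR
      simp only [Finset.bipartiteAbove, Rs, Finset.mem_filter, Finset.mem_univ, true_and] at hR
      obtain ⟨⟨hRd, hRc⟩, hDR⟩ := hR
      have h1 : (R \ D).card = 1 := by
        have := Finset.card_sdiff_add_card_eq_card hDR
        omega
      obtain ⟨x, hx⟩ := Finset.card_eq_one.1 h1
      have hx' : x ∈ R \ D := by rw [hx]; simp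
      rw [Finset.mem_sdiff] at hx'
      have hRx : insert x D = R := by
        rw [Finset.insert_eq, ← hx, Finset.sdiff_union_of_subset hDR]
      refine ⟨x, ?_, hRx⟩
      simp only [Finset.mem_filter, Finset.mem_univ, true_and]
      exact k2 x hx'.2 (by rw [hRx]; exact hRd)
  have hpair : ∀ D : Finset X, Dom u D → D.card + 1 = Fintype.card I → ∀ mn : I → X,
      (∀ i, mn i ∈ D ∧ ∀ x ∈ D, u i (mn i) ≤ u i x) → ∃ i j : I, i ≠ j ∧ mn i = mn j := by
    intro D hD hDc mn hmn
    obtain ⟨i, -, j, -, h, h'⟩ := Finset.exists_ne_map_eq_of_card_lt_of_maps_to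
      (s := (Finset.univ : Finset I)) (t := D) (f := mn) (by rw [Finset.card_univ]; omega)
      (fun i _ => (hmn i).1)
    exact ⟨i, j, h, h'⟩
  have hdoor : ∀ D ∈ Ds, D ≠ D0 → Even (Finset.bipartiteAbove (fun D R => D ⊆ R) Rs D).card := by
    intro D hD hDD
    simp only [Ds, Finset.mem_filter, Finset.mem_univ, true_and] at hD
    obtain ⟨hDd, hDc, hDi⟩ := hD
    have hDne : D.Nonempty := Finset.card_pos.1 (by omega)
    obtain ⟨mn, hmn⟩ := exists_mn u hDne
    obtain ⟨i, j, hij, heq⟩ := hpair D hDd hDc mn hmn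
    have habove : ∀ k, Above u mn k (s k) := by
      intro k l hl
      by_contra hlt
      apply hDD
      have hsub : ∀ x ∈ D, x ∈ Set.range s := by
        intro x hx
        by_contra hxs
        have h1 := hs2 l k hl x hxs
        have h2 := (hmn l).2 x hx
        exact hlt (lt_of_le_of_lt h2 h1)
      ext x
      simp only [D0, Finset.mem_image, Finset.mem_erase, Finset.mem_univ, and_true]
      constructor
      · intro hx
        obtain ⟨a, rfl⟩ := hsub x hx
        refine ⟨a, ?_, rfl⟩
        have : c (s a) ∈ D.image c := Finset.mem_image_of_mem _ hx
        rw [hDi, hcs] at this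
        simpa using this
      · rintro ⟨a, ha, rfl⟩
        have : a ∈ D.image c := by rw [hDi]; simp [ha]
        obtain ⟨x, hx, hxa⟩ := Finset.mem_image.1 this
        obtain ⟨b, rfl⟩ := hsub x hx
        rw [hcs] at hxa
        exact hxa ▸ hx
    obtain ⟨zi, hzi⟩ := exists_top ⟨s i, habove i⟩
    obtain ⟨zj, hzj⟩ := exists_top ⟨s j, habove j⟩
    rw [key D hDd hDc mn hmn i j hij heq]
    have : (Finset.univ.filter fun z => Top u mn i z ∨ Top u mn j z) = {zi, zj} := by
      ext z
      simp only [Finset.mem_filter, Finset.mem_univ, true_and, Finset.mem_insert,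
        Finset.mem_singleton]
      constructor
      · rintro (h | h)
        · exact Or.inl (top_unique hu h hzi)
        · exact Or.inr (top_unique hu h hzj)
      · rintro (rfl | rfl)
        · exact Or.inl hzi
        · exact Or.inr hzj
    rw [this, Finset.card_pair]
    · exact even_two
    · rintro rfl
      exact (door hu hDd hDc hmn hij heq).2.2 _ hzi hzj
  have hD0c : D0.card + 1 = Fintype.card I := by
    rw [Finset.card_image_of_injective _ hsinj, Finset.card_erase_of_mem (Finset.mem_univ _),
      Finset.card_univ]; omega
  have hD0d : Dom u D0 := by
    intro y
    by_cases hy : y ∈ Set.range s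
    · obtain ⟨k, rfl⟩ := hy
      refine ⟨k, fun x hx => hs1 _ _⟩
    · refine ⟨i0, fun x hx => ?_⟩
      simp only [D0, Finset.mem_image, Finset.mem_erase, Finset.mem_univ, and_true] at hx
      obtain ⟨a, ha, rfl⟩ := hx
      exact (hs2 i0 a ha.symm y hy).le
  have hD0m : D0 ∈ Ds := by
    simp only [Ds, Finset.mem_filter, Finset.mem_univ, true_and]
    refine ⟨hD0d, hD0c, ?_⟩
    simp only [D0, Finset.image_image]
    have : c ∘ s = id := funext hcs
    rw [this, Finset.image_id]
  have hD0one : (Finset.bipartiteAbove (fun D R => D ⊆ R) Rs D0).card = 1 := by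
    have hDne : D0.Nonempty := Finset.card_pos.1 (by omega)
    obtain ⟨mn, hmn⟩ := exists_mn u hDne
    have hmem : ∀ l, l ≠ i0 → s l ∈ D0 := fun l hl => by simp [D0, hl, hsinj.eq_iff]
    have hmnl : ∀ l, l ≠ i0 → mn l = s l := by
      intro l hl
      exact hu l (le_antisymm ((hmn l).2 _ (hmem l hl)) (hs1 _ _))
    obtain ⟨j, hj, hjs⟩ : ∃ j, j ≠ i0 ∧ s j = mn i0 := by
      have := (hmn i0).1
      simpa [D0] using this
    have heq : mn i0 = mn j := by rw [hmnl j hj, hjs]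
    rw [key D0 hD0d hD0c mn hmn i0 j hj.symm heq]
    obtain ⟨z, hz⟩ := exists_top (u := u) (mn := mn) (k := i0) ⟨t0, fun l hl => by
      rw [hmnl l hl]
      exact lt_of_le_of_ne (hs1 _ _) (fun h => ht0 ⟨l, hu l h⟩)⟩
    rw [Finset.card_eq_one]
    refine ⟨z, ?_⟩
    ext y
    simp only [Finset.mem_filter, Finset.mem_univ, true_and, Finset.mem_singleton]
    constructor
    · rintro (h | h)
      · exact top_unique hu h hz
      · exfalso
        have h := h.1
        have h0 := h i0 hj.symm
        rw [← hjs] at h0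
        by_cases hy : y ∈ Set.range s
        · obtain ⟨l, rfl⟩ := hy
          by_cases hl0 : l = i0
          · subst hl0
            exact absurd h0 (not_lt.2 (hs1 _ _))
          by_cases hlj : l = j
          · subst hlj
            exact lt_irrefl _ h0
          · have := h l hlj
            rw [hmnl l hl0] at this
            exact lt_irrefl _ this
        · exact lt_asymm h0 (hs2 i0 j hj.symm y hy)
    · rintro rfl
      exact Or.inl hz
  have e1 : Even (∑ R ∈ Rs, (Finset.bipartiteBelow (fun D R => D ⊆ R) Ds R).card) :=
    Finset.even_sum _ hroom
  rw [← hsum, ← Finset.add_sum_erase _ _ hD0m, hD0one] at e1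
  have e2 : Even (∑ D ∈ Ds.erase D0, (Finset.bipartiteAbove (fun D R => D ⊆ R) Rs D).card) :=
    Finset.even_sum _ (fun D hD => hdoor D (Finset.mem_of_mem_erase hD) (Finset.ne_of_mem_erase hD))
  rw [Nat.even_add] at e1
  exact absurd (e1.2 e2) (by decide)


theorem grid {I : Type*} [Fintype I] [DecidableEq I] (hI : 2 ≤ Fintype.card I) (m : ℕ)
    (c : (I → ℕ) → I) :
    ∃ x0 : I → ℕ, ∑ i, x0 i = m ∧ ∀ i, x0 i ≤ Fintype.card I ∨
      ∃ x : I → ℕ, ∑ i, x i = m ∧ c x = i ∧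
        ∀ l, x l ≤ x0 l + Fintype.card I ∧ x0 l ≤ x l + Fintype.card I := by
  classical
  let T := {x // x ∈ Finset.piAntidiag (Finset.univ : Finset I) m}
  have hT : ∀ x : T, ∑ i, x.1 i = m := fun x => (Finset.mem_piAntidiag.1 x.2).1
  let mk : ∀ x : I → ℕ, ∑ i, x i = m → T := fun x hx =>
    ⟨x, Finset.mem_piAntidiag.2 ⟨hx, fun _ _ => Finset.mem_univ _⟩⟩
  let e := Fintype.equivFin (T ⊕ I)
  let a : I → T ⊕ I → ℤ := fun i => Sum.elim (fun x => (x.1 i : ℤ)) (fun j => if j = i then -1 else m + 1)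
  let u : I → T ⊕ I → ℤ ×ₗ Fin (Fintype.card (T ⊕ I)) := fun i p => toLex (a i p, e p)
  have hu : ∀ i, Function.Injective (u i) := by
    intro i p q h
    have : (a i p, e p) = (a i q, e q) := toLex.injective h
    exact e.injective (Prod.ext_iff.1 this).2
  have hlt : ∀ i p q, a i p < a i q → u i p < u i q := fun i p q h => by
    rw [Prod.Lex.lt_iff]; exact Or.inl h
  have hle : ∀ i p q, u i p ≤ u i q → a i p ≤ a i q := fun i p q h => by
    by_contra hh
    exact absurd (hlt i q p (not_le.1 hh)) (not_lt.2 h)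
  have hTm : ∀ (x : T) i, x.1 i ≤ m := fun x i => by
    exact (Finset.single_le_sum (f := x.1) (fun _ _ => Nat.zero_le _) (Finset.mem_univ i)).trans
      (hT x).le
  obtain ⟨i1⟩ : Nonempty I := Fintype.card_pos_iff.1 (by omega)
  let t0 : T := mk (Pi.single i1 m) (by simp)
  obtain ⟨R, hR, hRc⟩ := scarf (u := u) hu hI Sum.inr
    (by
      intro i y
      by_cases h : y = Sum.inr i
      · rw [h]
      · apply le_of_lt; apply hlt
        rcases y with x | j
        · simp only [a, Sum.elim_inl, Sum.elim_inr, if_true]; omega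
        · have : j ≠ i := fun h' => h (by rw [h'])
          simp only [a, Sum.elim_inr, if_true, if_neg this]; omega)
    (by
      intro i j hij y hy
      apply hlt
      rcases y with x | k
      · have := hTm x i
        simp [a, hij.symm]; omega
      · exact absurd ⟨k, rfl⟩ hy)
    (Sum.inl t0) (by simp) (Sum.elim (fun x => c x.1) id) (by simp)
  have hcol : ∀ i, Sum.inr i ∉ R → ∃ x : T, Sum.inl x ∈ R ∧ c x.1 = i := by
    intro i hi
    have : i ∈ R.image (Sum.elim (fun x : T => c x.1) id) := by rw [hRc]; simp
    obtain ⟨p, hp, hpi⟩ := Finset.mem_image.1 this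
    rcases p with x | j
    · exact ⟨x, hp, hpi⟩
    · simp only [Sum.elim_inr, id] at hpi
      subst hpi; exact absurd hp hi
  have hdom : ∀ y : T, ∃ i, Sum.inr i ∉ R ∧ ∀ x : T, Sum.inl x ∈ R → y.1 i ≤ x.1 i := by
    intro y
    obtain ⟨i, hi⟩ := hR (Sum.inl y)
    refine ⟨i, fun h => ?_, fun x hx => ?_⟩
    · have := hle _ _ _ (hi _ h)
      simp [a] at this
      omega
    · have := hle _ _ _ (hi _ hx)
      simpa [a] using this
  obtain ⟨x0, hx0⟩ : ∃ x0 : T, Sum.inl x0 ∈ R := by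
    obtain ⟨i, hi, -⟩ := hdom t0
    obtain ⟨x, hx, -⟩ := hcol i hi
    exact ⟨x, hx⟩
  have hmin : ∀ i, ∃ x : T, Sum.inl x ∈ R ∧ ∀ y : T, Sum.inl y ∈ R → x.1 i ≤ y.1 i := by
    intro i
    obtain ⟨x, hx, h⟩ := (Finset.univ.filter fun x : T => Sum.inl x ∈ R).exists_min_image
      (fun x => x.1 i) ⟨x0, by simpa using hx0⟩
    exact ⟨x, by simpa using hx, fun y hy => h y (by simpa using hy)⟩
  choose mi hmi hmi' using hmin
  let mm : I → ℕ := fun i => if Sum.inr i ∈ R then 0 else (mi i).1 i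
  have hmm : ∀ x : T, Sum.inl x ∈ R → ∀ i, mm i ≤ x.1 i := by
    intro x hx i
    by_cases h : Sum.inr i ∈ R
    · simp [mm, h]
    · simpa [mm, h] using hmi' i x hx
  have hsum : m < ∑ i, mm i + Fintype.card I := by
    by_contra hcon
    have h1 : ∑ i, (mm i + 1) ≤ m := by
      rw [Finset.sum_add_distrib]; simpa using hcon
    let y : I → ℕ := fun i => mm i + 1 + if i = i1 then m - ∑ i, (mm i + 1) else 0
    have hy : ∑ i, y i = m := by
      simp only [y]
      rw [Finset.sum_add_distrib, Finset.sum_ite_eq']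
      simp only [Finset.mem_univ, if_true]
      omega
    obtain ⟨i, hi, hi'⟩ := hdom (mk y hy)
    have h2 := hi' _ (hmi i)
    have h3 : mm i = (mi i).1 i := by simp [mm, hi]
    simp only [mk, y] at h2
    omega
  have hup : ∀ x : T, Sum.inl x ∈ R → ∀ l, x.1 l ≤ mm l + Fintype.card I := by
    intro x hx l
    have h1 : ∑ i, (x.1 i - mm i) + ∑ i, mm i = m := by
      rw [← Finset.sum_add_distrib]
      refine Eq.trans ?_ (hT x)
      exact Finset.sum_congr rfl fun i _ => Nat.sub_add_cancel (hmm x hx i)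
    have h2 := Finset.single_le_sum (f := fun i => x.1 i - mm i) (fun _ _ => Nat.zero_le _)
      (Finset.mem_univ l)
    omega
  refine ⟨x0.1, hT x0, fun i => ?_⟩
  by_cases h : Sum.inr i ∈ R
  · left
    have := hup x0 hx0 i
    simpa [mm, h] using this
  · right
    obtain ⟨x, hx, hxc⟩ := hcol i h
    refine ⟨x.1, hT x, hxc, fun l => ?_⟩
    have h1 := hup x0 hx0 l
    have h2 := hup x hx l
    have h3 := hmm x hx l
    have h4 := hmm x0 hx0 l
    omega

theorem brouwer {I : Type*} [Fintype I] [DecidableEq I] (hI : 2 ≤ Fintype.card I)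
    (f : (I → ℝ) → (I → ℝ)) (hf : ContinuousOn f (stdSimplex ℝ I))
    (hm : ∀ x ∈ stdSimplex ℝ I, f x ∈ stdSimplex ℝ I) :
    ∃ x ∈ stdSimplex ℝ I, f x = x := by
  classical
  obtain ⟨i1⟩ : Nonempty I := Fintype.card_pos_iff.1 (by omega)
  have hcpt : IsCompact (stdSimplex ℝ I) := isCompact_stdSimplex ℝ I
  have happrox : ∀ ε > 0, ∃ x ∈ stdSimplex ℝ I, ∀ i, x i - ε ≤ f x i := by
    intro ε hε
    have huc := hcpt.uniformContinuousOn_of_continuous hf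
    obtain ⟨δ, hδ, hδ'⟩ := Metric.uniformContinuousOn_iff.1 huc (ε / 2) (by linarith)
    obtain ⟨m, hm0⟩ := exists_nat_gt ((Fintype.card I : ℝ) / min δ (ε / 2))
    have hmin : 0 < min δ (ε / 2) := lt_min hδ (by linarith)
    have hmpos : (0 : ℝ) < m := lt_of_le_of_lt (by positivity) hm0
    have hnm : (Fintype.card I : ℝ) / m < min δ (ε / 2) := by
      rw [div_lt_iff₀ hmin] at hm0
      rw [div_lt_iff₀ hmpos]; linarith
    let P : (I → ℕ) → I → ℝ := fun x i => x i / m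
    have hP : ∀ x : I → ℕ, ∑ i, x i = m → P x ∈ stdSimplex ℝ I := by
      intro x hx
      refine ⟨fun i => by positivity, ?_⟩
      simp only [P]
      rw [← Finset.sum_div, ← Nat.cast_sum, hx, div_self hmpos.ne']
    have hlab : ∀ x : I → ℕ, ∃ i, ∑ i, x i = m → P x i ≤ f (P x) i := by
      intro x
      by_cases hx : ∑ i, x i = m
      · obtain ⟨i, -, hi⟩ := Finset.exists_le_of_sum_le (s := Finset.univ) (f := P x)
          (g := f (P x)) ⟨i1, Finset.mem_univ _⟩
          (by rw [(hP x hx).2, (hm _ (hP x hx)).2])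
        exact ⟨i, fun _ => hi⟩
      · exact ⟨i1, fun h => absurd h hx⟩
    choose c hc using hlab
    obtain ⟨x0, hx0, h⟩ := grid hI m c
    refine ⟨P x0, hP x0 hx0, fun i => ?_⟩
    rcases h i with h | ⟨x, hx, rfl, hxx⟩
    · have h1 : P x0 i ≤ (Fintype.card I : ℝ) / m := by
        simp only [P]
        gcongr
      have h2 := (hm _ (hP x0 hx0)).1 i
      have := min_le_right δ (ε / 2)
      linarith
    · have hd : ∀ l, |P x l - P x0 l| ≤ (Fintype.card I : ℝ) / m := by
        intro l
        simp only [P]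
        rw [← sub_div, abs_div, abs_of_pos hmpos]
        gcongr
        have h1 : (x l : ℝ) ≤ x0 l + Fintype.card I := by exact_mod_cast (hxx l).1
        have h2 : (x0 l : ℝ) ≤ x l + Fintype.card I := by exact_mod_cast (hxx l).2
        rw [abs_le]; constructor <;> linarith
      have hdist : dist (P x) (P x0) < δ := by
        rw [dist_pi_lt_iff hδ]
        intro l
        rw [Real.dist_eq]
        exact (hd l).trans_lt (hnm.trans_le (min_le_left _ _))
      have h3 := hδ' _ (hP x hx) _ (hP x0 hx0) hdist
      have h4 := (dist_le_pi_dist (f (P x)) (f (P x0)) (c x)).trans_lt h3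
      rw [Real.dist_eq, abs_lt] at h4
      have h5 := hc x hx
      have h6 := hd (c x)
      rw [abs_le] at h6
      have := min_le_right δ (ε / 2)
      linarith
  obtain ⟨x, hx, hmax⟩ := hcpt.exists_isMaxOn (f := fun x => Finset.univ.inf' ⟨i1, Finset.mem_univ _⟩
    (fun i => f x i - x i)) ⟨_, single_mem_stdSimplex ℝ i1⟩ (by
      apply ContinuousOn.finset_inf'_apply
      intro i _
      exact ((continuous_apply i).comp_continuousOn hf).sub (continuous_apply i).continuousOn)
  have hge : ∀ i, x i ≤ f x i := by
    intro i
    apply le_of_forall_pos_le_add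
    intro ε hε
    obtain ⟨y, hy, hy'⟩ := happrox ε hε
    have h1 := hmax hy
    simp only [Set.mem_ofPred_eq] at h1
    have h2 : -ε ≤ Finset.univ.inf' ⟨i1, Finset.mem_univ _⟩ (fun i => f y i - y i) := by
      apply Finset.le_inf'
      intro i _
      linarith [hy' i]
    have h3 := Finset.inf'_le (fun i => f x i - x i) (Finset.mem_univ i)
    linarith
  refine ⟨x, hx, ?_⟩
  have hs : ∑ i, x i = ∑ i, f x i := by rw [hx.2, (hm x hx).2]
  have := (Finset.sum_eq_sum_iff_of_le (fun i _ => hge i)).1 hs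
  funext i
  exact (this i (Finset.mem_univ i)).symm

theorem kkm (U : Fin 6 → Set (Fin 6 → ℝ)) (hU : ∀ i, IsOpen (U i))
    (hcov : ∀ x ∈ stdSimplex ℝ (Fin 6), ∃ i, x ∈ U i)
    (hb : ∀ x ∈ stdSimplex ℝ (Fin 6), ∀ i, x i = 0 → x ∉ U i) :
    ∃ x ∈ stdSimplex ℝ (Fin 6), ∀ i, x ∈ U i := by
  by_contra hno
  push Not at hno
  let d : Fin 6 → (Fin 6 → ℝ) → ℝ := fun i x => Metric.infDist x (U i)ᶜ
  have hne : ∀ i, ((U i)ᶜ).Nonempty := fun i =>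
    ⟨Pi.single (i + 1) 1, hb _ (single_mem_stdSimplex ℝ (i + 1)) i (by
      have : i ≠ i + 1 := by revert i; decide
      simp [this])⟩
  have hd0 : ∀ i x, 0 ≤ d i x := fun i x => Metric.infDist_nonneg
  have hdz : ∀ i x, x ∉ U i → d i x = 0 := fun i x hx => Metric.infDist_zero_of_mem hx
  have hdp : ∀ i x, x ∈ U i → 0 < d i x := by
    intro i x hx
    refine lt_of_le_of_ne (hd0 i x) (fun h => ?_)
    have := ((hU i).isClosed_compl.mem_iff_infDist_zero (hne i)).2 h.symm
    exact this hx
  have hdc : ∀ i, Continuous (d i) := fun i => Metric.continuous_infDist_pt _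
  have hsum : ∀ x ∈ stdSimplex ℝ (Fin 6), 0 < ∑ i, d i x := by
    intro x hx
    obtain ⟨i, hi⟩ := hcov x hx
    exact Finset.sum_pos' (fun i _ => hd0 i x) ⟨i, Finset.mem_univ _, hdp i x hi⟩
  let f : (Fin 6 → ℝ) → (Fin 6 → ℝ) := fun x i => d (i + 1) x / ∑ j, d j x
  obtain ⟨x, hx, hfx⟩ := brouwer (by simp) f
    (by
      apply continuousOn_pi.2
      intro i
      exact (hdc _).continuousOn.div (continuous_finsetSum _ fun j _ => hdc j).continuousOn
        (fun x hx => (hsum x hx).ne'))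
    (by
      intro x hx
      refine ⟨fun i => div_nonneg (hd0 _ _) (hsum x hx).le, ?_⟩
      simp only [f]
      have := Equiv.sum_comp (Equiv.addRight (1 : Fin 6)) (fun i => d i x)
      simp only [Equiv.coe_addRight] at this
      rw [← Finset.sum_div, this]
      exact div_self (hsum x hx).ne')
  obtain ⟨i, hi⟩ := hno x hx
  have step : ∀ j, d (j + 1) x = 0 → x j = 0 := by
    intro j hj
    rw [← hfx]; simp [f, hj]
  have step2 : ∀ j, x j = 0 → d j x = 0 := fun j hj => hdz j x (hb x hx j hj)
  have step3 : ∀ j, d (j + 1) x = 0 → d j x = 0 := fun j hj => step2 j (step j hj)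
  have hi' := hdz i x hi
  have hall : ∀ j, d j x = 0 := by
    have hk : ∀ k : ℕ, ∀ j : Fin 6, j + k • (1 : Fin 6) = i → d j x = 0 := by
      intro k
      induction k with
      | zero => intro j hj; rw [zero_smul, add_zero] at hj; rw [hj]; exact hi'
      | succ k ih =>
        intro j hj
        apply step3
        apply ih
        rw [← hj, succ_nsmul, add_assoc, add_comm 1]
    intro j
    apply hk (i - j).val j
    have h1 : ∀ a : Fin 6, a.val • (1 : Fin 6) = a := by decide
    rw [h1]
    abel
  have := hsum x hx
  simp [hall] at this

end Scarf

namespace ThreeLines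

open Real

/-- Chord function: positive on the side of the chord facing the arc from `a` to `b`. -/
noncomputable def G (r a b : ℝ) (z : Plane) : ℝ :=
  z 0 * cos ((a + b) / 2) + z 1 * sin ((a + b) / 2) - r * cos ((b - a) / 2)

theorem G_flip (r a b : ℝ) (z : Plane) : G r b (a + 2 * π) z = - G r a b z := by
  unfold G
  rw [show (b + (a + 2 * π)) / 2 = (a + b) / 2 + π by ring,
    show (a + 2 * π - b) / 2 = π - (b - a) / 2 by ring, cos_add_pi, sin_add_pi, cos_pi_sub]
  ring

theorem G_empty {r a b c : ℝ} {z : Plane} (hz : z 0 ^ 2 + z 1 ^ 2 ≤ r ^ 2) (hr : 0 ≤ r)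
    (hab : a ≤ b) (hbc : b ≤ c) (hca : c ≤ a + 2 * π) (h1 : 0 < G r a b z) (h2 : G r a c z < 0) :
    False := by
  have hw : z 0 * cos a + z 1 * sin a ≤ r := by
    apply le_of_sq_le_sq _ hr
    have h3 := sin_sq_add_cos_sq a
    nlinarith [sq_nonneg (z 0 * sin a - z 1 * cos a)]
  obtain ⟨α, hα⟩ : ∃ α, α = (b - a) / 2 := ⟨_, rfl⟩
  obtain ⟨β, hβ⟩ : ∃ β, β = (c - a) / 2 := ⟨_, rfl⟩
  obtain ⟨w1, hw1⟩ : ∃ w, w = z 0 * cos a + z 1 * sin a - r := ⟨_, rfl⟩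
  obtain ⟨w2, hw2⟩ : ∃ w, w = z 1 * cos a - z 0 * sin a := ⟨_, rfl⟩
  have e1 : G r a b z = w1 * cos α + w2 * sin α := by
    unfold G
    rw [show (a + b) / 2 = a + α by rw [hα]; ring, ← hα, cos_add, sin_add, hw1, hw2]
    ring
  have e2 : G r a c z = w1 * cos β + w2 * sin β := by
    unfold G
    rw [show (a + c) / 2 = a + β by rw [hβ]; ring, ← hβ, cos_add, sin_add, hw1, hw2]
    ring
  rw [e1] at h1
  rw [e2] at h2
  have hw1' : w1 ≤ 0 := by linarith
  have a0 : 0 ≤ α := by linarith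
  have ab : α ≤ β := by linarith
  have bp : β ≤ π := by linarith
  rcases eq_or_lt_of_le a0 with h | h
  · rw [← h] at h1; simp at h1; linarith
  rcases eq_or_lt_of_le (ab.trans bp) with h' | h'
  · have : β = π := by linarith
    rw [h'] at h1; rw [this] at h2; linarith
  have s1 := sin_pos_of_pos_of_lt_pi h h'
  have s2 := sin_nonneg_of_nonneg_of_le_pi (a0.trans ab) bp
  have s3 := sin_nonneg_of_nonneg_of_le_pi (sub_nonneg.2 ab) (by linarith)
  rw [sin_sub] at s3
  have e3 : sin α * (w1 * cos β + w2 * sin β) = sin β * (w1 * cos α + w2 * sin α)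
     - w1 * (sin β * cos α - cos β * sin α) := by ring
  have := mul_neg_of_pos_of_neg s1 h2
  have := mul_nonneg s2 h1.le
  have := mul_nonneg_of_nonpos_of_nonpos hw1' (neg_nonpos.2 s3)
  linarith

theorem no_both {w0 w1 p q t : ℝ} (hpq : p ≤ q) (hqt : q ≤ t) (htp : t ≤ p + π)
    (h1 : 0 < w0 * cos p + w1 * sin p) (h2 : w0 * cos q + w1 * sin q < 0)
    (h3 : 0 < w0 * cos t + w1 * sin t) : False := by
  rcases eq_or_lt_of_le (hpq.trans hqt) with h | h
  · have : q = p := by linarith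
    rw [this] at h2; linarith
  rcases eq_or_lt_of_le htp with h' | h'
  · rw [h', cos_add_pi, sin_add_pi] at h3; linarith
  have s1 := sin_pos_of_pos_of_lt_pi (x := t - p) (by linarith) (by linarith)
  have s2 := sin_nonneg_of_nonneg_of_le_pi (x := t - q) (by linarith) (by linarith)
  have s3 := sin_nonneg_of_nonneg_of_le_pi (x := q - p) (by linarith) (by linarith)
  have e : sin (t - p) * (w0 * cos q + w1 * sin q) = sin (t - q) * (w0 * cos p + w1 * sin p) +
      sin (q - p) * (w0 * cos t + w1 * sin t) := by
    rw [sin_sub, sin_sub, sin_sub]; ring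
  have := mul_neg_of_pos_of_neg s1 h2
  have := mul_nonneg s2 h1.le
  have := mul_nonneg s3 h3.le
  linarith

theorem G_continuous {Y : Type*} [TopologicalSpace Y] (r : ℝ) {a b : Y → ℝ} {z : Y → Plane}
    (ha : Continuous a) (hb : Continuous b) (hz : Continuous z) :
    Continuous fun y => G r (a y) (b y) (z y) := by
  unfold G
  fun_prop

theorem G_convex_pos (r a b : ℝ) : Convex ℝ {z : Plane | 0 < G r a b z} := by
  intro x hx y hy s t hs ht hst
  simp only [Set.mem_ofPred_eq] at *
  have : G r a b (s • x + t • y) = s * G r a b x + t * G r a b y := by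
    simp only [G, PiLp.add_apply, PiLp.smul_apply, smul_eq_mul]
    linear_combination (- r * cos ((b - a) / 2)) * (1 - hst)
  rw [this]
  rcases eq_or_lt_of_le hs with h | h
  · have : t = 1 := by linarith
    rw [← h, this]; simpa using hy
  · have := mul_pos h hx
    have := mul_nonneg ht hy.le
    linarith

theorem G_hull_pos {r a b : ℝ} {A B : Set Plane} (hA : ∀ z ∈ A, 0 < G r a b z)
    (hB : ∀ z ∈ B, 0 < G r a b z) {z : Plane} (hz : z ∈ convexHull ℝ (A ∪ B)) : 0 < G r a b z := by
  have : convexHull ℝ (A ∪ B) ⊆ {z : Plane | 0 < G r a b z} :=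
    convexHull_min (Set.union_subset hA hB) (G_convex_pos r a b)
  exact this hz

theorem G_hull_neg {r a b : ℝ} {A B : Set Plane} (hA : ∀ z ∈ A, G r a b z < 0)
    (hB : ∀ z ∈ B, G r a b z < 0) {z : Plane} (hz : z ∈ convexHull ℝ (A ∪ B)) : G r a b z < 0 := by
  have := G_hull_pos (r := r) (a := b) (b := a + 2 * π) (A := A) (B := B)
    (fun z hz => by rw [G_flip]; linarith [hA z hz]) (fun z hz => by rw [G_flip]; linarith [hB z hz]) hz
  rw [G_flip] at this
  linarith

theorem sign_const {K : Set Plane} (hK : IsConnected K) {f : Plane → ℝ} (hf : Continuous f)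
    (h : ∀ z ∈ K, f z ≠ 0) : (∀ z ∈ K, 0 < f z) ∨ (∀ z ∈ K, f z < 0) := by
  by_contra hcon
  push Not at hcon
  obtain ⟨⟨x, hx, hx'⟩, y, hy, hy'⟩ := hcon
  obtain ⟨z, hz, hz'⟩ := hK.isPreconnected.intermediate_value hx hy hf.continuousOn ⟨hx', hy'⟩
  exact h z hz hz'

/-- The six dividing angles. -/
noncomputable def th (k : Fin 6) (x : Fin 6 → ℝ) : ℝ :=
  2 * π * ∑ j ∈ Finset.univ.filter (· < k), x j

theorem th_continuous (k : Fin 6) : Continuous (th k) := by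
  unfold th
  fun_prop

theorem th_vals {x : Fin 6 → ℝ} (hx : x ∈ stdSimplex ℝ (Fin 6)) :
    th 0 x = 0 ∧ th 1 x = th 0 x + 2 * π * x 0 ∧ th 2 x = th 1 x + 2 * π * x 1 ∧
    th 3 x = th 2 x + 2 * π * x 2 ∧ th 4 x = th 3 x + 2 * π * x 3 ∧
    th 5 x = th 4 x + 2 * π * x 4 ∧ 2 * π = th 5 x + 2 * π * x 5 := by
  have h := hx.2
  rw [Fin.sum_univ_six] at h
  have f0 : Finset.univ.filter (· < (0 : Fin 6)) = ∅ := by decide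
  have f1 : Finset.univ.filter (· < (1 : Fin 6)) = {0} := by decide
  have f2 : Finset.univ.filter (· < (2 : Fin 6)) = {0, 1} := by decide
  have f3 : Finset.univ.filter (· < (3 : Fin 6)) = {0, 1, 2} := by decide
  have f4 : Finset.univ.filter (· < (4 : Fin 6)) = {0, 1, 2, 3} := by decide
  have f5 : Finset.univ.filter (· < (5 : Fin 6)) = {0, 1, 2, 3, 4} := by decide
  simp only [th, f0, f1, f2, f3, f4, f5]
  refine ⟨by simp, ?_, ?_, ?_, ?_, ?_, ?_⟩
  · simp
  all_goals simp
  all_goals first | ring1 | (linear_combination (-2 * π) * h)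

/-- Sign conditions defining the six sectors. -/
def Sec (r : ℝ) (i : Fin 6) (x : Fin 6 → ℝ) (z : Plane) : Prop :=
  match i with
  | 0 => 0 < G r (th 0 x) (th 3 x) z ∧ G r (th 1 x) (th 4 x) z < 0
  | 1 => 0 < G r (th 1 x) (th 4 x) z ∧ G r (th 2 x) (th 5 x) z < 0
  | 2 => 0 < G r (th 2 x) (th 5 x) z ∧ 0 < G r (th 0 x) (th 3 x) z
  | 3 => G r (th 0 x) (th 3 x) z < 0 ∧ 0 < G r (th 1 x) (th 4 x) z
  | 4 => G r (th 1 x) (th 4 x) z < 0 ∧ 0 < G r (th 2 x) (th 5 x) z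
  | 5 => G r (th 2 x) (th 5 x) z < 0 ∧ G r (th 0 x) (th 3 x) z < 0

theorem Sec_open (r : ℝ) (i : Fin 6) : IsOpen {p : (Fin 6 → ℝ) × Plane | Sec r i p.1 p.2} := by
  have hc : ∀ k l : Fin 6, Continuous fun p : (Fin 6 → ℝ) × Plane =>
      G r (th k p.1) (th l p.1) p.2 := fun k l =>
    G_continuous r ((th_continuous k).comp continuous_fst) ((th_continuous l).comp continuous_fst)
      continuous_snd
  have hp : ∀ k l : Fin 6, IsOpen {p : (Fin 6 → ℝ) × Plane | 0 < G r (th k p.1) (th l p.1) p.2} :=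
    fun k l => isOpen_lt continuous_const (hc k l)
  have hn : ∀ k l : Fin 6, IsOpen {p : (Fin 6 → ℝ) × Plane | G r (th k p.1) (th l p.1) p.2 < 0} :=
    fun k l => isOpen_lt (hc k l) continuous_const
  fin_cases i
  · exact (hp 0 3).inter (hn 1 4)
  · exact (hp 1 4).inter (hn 2 5)
  · exact (hp 2 5).inter (hp 0 3)
  · exact (hn 0 3).inter (hp 1 4)
  · exact (hn 1 4).inter (hp 2 5)
  · exact (hn 2 5).inter (hn 0 3)

theorem G_shift (r a b : ℝ) (z : Plane) : G r (a + 2 * π) (b + 2 * π) z = G r a b z := by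
  rw [G_flip, G_flip, neg_neg]

theorem Sec_empty {r : ℝ} (hr : 0 ≤ r) {i : Fin 6} {x : Fin 6 → ℝ}
    (hx : x ∈ stdSimplex ℝ (Fin 6)) (hi : x i = 0) {z : Plane} (hz : z 0 ^ 2 + z 1 ^ 2 ≤ r ^ 2)
    (h : Sec r i x z) : False := by
  obtain ⟨h0, h1, h2, h3, h4, h5, h6⟩ := th_vals hx
  have hn : ∀ i, 0 ≤ 2 * π * x i := fun i => mul_nonneg (by positivity) (hx.1 i)
  have n0 := hn 0
  have n1 := hn 1
  have n2 := hn 2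
  have n3 := hn 3
  have n4 := hn 4
  have n5 := hn 5
  fin_cases i <;> simp only [Sec] at h <;> obtain ⟨p, q⟩ := h <;> simp at hi <;>
    simp only [hi, mul_zero, add_zero] at h1 h2 h3 h4 h5 h6
  · rw [h1] at q
    exact G_empty hz hr (by linarith) (by linarith) (by linarith) p q
  · rw [h2] at q
    exact G_empty hz hr (by linarith) (by linarith) (by linarith) p q
  · have q' : G r (th 2 x) (th 0 x + 2 * π) z < 0 := by rw [← h3, G_flip]; linarith
    exact G_empty hz hr (by linarith) (by linarith) (by linarith) p q'
  · have p' : 0 < G r (th 3 x) (th 0 x + 2 * π) z := by rw [G_flip]; linarith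
    have q' : G r (th 3 x) (th 1 x + 2 * π) z < 0 := by rw [← h4, G_flip]; linarith
    exact G_empty hz hr (by linarith) (by linarith) (by linarith) p' q'
  · have p' : 0 < G r (th 4 x) (th 1 x + 2 * π) z := by rw [G_flip]; linarith
    have q' : G r (th 4 x) (th 2 x + 2 * π) z < 0 := by rw [← h5, G_flip]; linarith
    exact G_empty hz hr (by linarith) (by linarith) (by linarith) p' q'
  · have p' : 0 < G r (th 5 x) (th 2 x + 2 * π) z := by rw [G_flip]; linarith
    have q' : G r (th 5 x) (th 3 x + 2 * π) z < 0 := by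
      rw [show th 5 x = th 0 x + 2 * π by linarith, G_shift]; linarith
    exact G_empty hz hr (by linarith) (by linarith) (by linarith) p' q'

theorem bounded_case (F : Set (Set Plane)) (r : ℝ) (hr : 0 ≤ r)
    (hb : ∀ S ∈ F, ∀ z ∈ S, z 0 ^ 2 + z 1 ^ 2 ≤ r ^ 2)
    (hcpt : ∀ S ∈ F, IsCompact S)
    (hconn : ∀ S ∈ F, IsConnected S)
    (htight : ∀ A ∈ F, ∀ B ∈ F, ∀ C ∈ F, Tight A B C) :
    ∃ a b : Fin 3 → ℝ, ∀ S ∈ F, ∃ j, ∃ z ∈ S, G r (a j) (b j) z = 0 := by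
  by_contra hno
  push Not at hno
  obtain ⟨x, hx, hall⟩ := Scarf.kkm (fun i => {x | ∃ K ∈ F, ∀ z ∈ K, Sec r i x z})
    (by
      intro i
      rw [isOpen_iff_eventually]
      rintro x ⟨K, hK, hKx⟩
      have := (hcpt K hK).eventually_forall_of_forall_eventually (x₀ := x)
        (P := fun x z => Sec r i x z)
        (fun z hz => (Sec_open r i).mem_nhds (x := (x, z)) (hKx z hz))
      exact this.mono fun y hy => ⟨K, hK, hy⟩)
    (by
      intro x hx
      obtain ⟨K, hK, h⟩ := hno ![th 0 x, th 1 x, th 2 x] ![th 3 x, th 4 x, th 5 x]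
      have hc : ∀ a b, Continuous (G r a b) := fun a b =>
        G_continuous r continuous_const continuous_const continuous_id
      have s0 := sign_const (hconn K hK) (hc _ _) (h 0)
      have s1 := sign_const (hconn K hK) (hc _ _) (h 1)
      have s2 := sign_const (hconn K hK) (hc _ _) (h 2)
      simp at s0 s1 s2
      rcases s0 with s0 | s0
      · rcases s1 with s1 | s1
        · rcases s2 with s2 | s2
          · exact ⟨2, K, hK, fun z hz => ⟨s2 z hz, s0 z hz⟩⟩
          · exact ⟨1, K, hK, fun z hz => ⟨s1 z hz, s2 z hz⟩⟩
        · exact ⟨0, K, hK, fun z hz => ⟨s0 z hz, s1 z hz⟩⟩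
      · rcases s1 with s1 | s1
        · exact ⟨3, K, hK, fun z hz => ⟨s0 z hz, s1 z hz⟩⟩
        · rcases s2 with s2 | s2
          · exact ⟨4, K, hK, fun z hz => ⟨s1 z hz, s2 z hz⟩⟩
          · exact ⟨5, K, hK, fun z hz => ⟨s2 z hz, s0 z hz⟩⟩)
    (by
      rintro x hx i hi ⟨K, hK, h⟩
      obtain ⟨z, hz⟩ := (hconn K hK).nonempty
      exact Sec_empty hr hx hi (hb K hK z hz) (h z hz))
  obtain ⟨K0, m0, k0⟩ := hall 0
  obtain ⟨K1, m1, k1⟩ := hall 1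
  obtain ⟨K2, m2, k2⟩ := hall 2
  obtain ⟨K3, m3, k3⟩ := hall 3
  obtain ⟨K4, m4, k4⟩ := hall 4
  obtain ⟨K5, m5, k5⟩ := hall 5
  simp only [Sec] at k0 k1 k2 k3 k4 k5
  obtain ⟨z, ⟨z1, z2⟩, z3⟩ := htight K0 m0 K2 m2 K4 m4
  obtain ⟨y, ⟨y1, y2⟩, y3⟩ := htight K3 m3 K5 m5 K1 m1
  have a1 := G_hull_pos (fun z hz => (k0 z hz).1) (fun z hz => (k2 z hz).2) z1
  have a2 := G_hull_neg (fun z hz => (k0 z hz).2) (fun z hz => (k4 z hz).1) z2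
  have a3 := G_hull_pos (fun z hz => (k2 z hz).1) (fun z hz => (k4 z hz).2) z3
  have b1 := G_hull_neg (fun z hz => (k3 z hz).1) (fun z hz => (k5 z hz).2) y1
  have b2 := G_hull_pos (fun z hz => (k3 z hz).2) (fun z hz => (k1 z hz).1) y2
  have b3 := G_hull_neg (fun z hz => (k5 z hz).1) (fun z hz => (k1 z hz).2) y3
  obtain ⟨h0, h1, h2, h3, h4, h5, h6⟩ := th_vals hx
  have hn : ∀ i, 0 ≤ 2 * π * x i := fun i => mul_nonneg (by positivity) (hx.1 i)
  have n0 := hn 0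
  have n1 := hn 1
  have n2 := hn 2
  have n3 := hn 3
  have n4 := hn 4
  have n5 := hn 5
  unfold G at a1 a2 a3 b1 b2 b3
  exact no_both (w0 := z 0 - y 0) (w1 := z 1 - y 1) (p := (th 0 x + th 3 x) / 2)
    (q := (th 1 x + th 4 x) / 2) (t := (th 2 x + th 5 x) / 2) (by linarith) (by linarith)
    (by linarith) (by linarith) (by linarith) (by linarith)

theorem isLine_of {a b : ℝ} (c : ℝ) (h : a ≠ 0 ∨ b ≠ 0) :
    IsLine {z : Plane | a * z 0 + b * z 1 = c} := by
  have hpos : a ^ 2 + b ^ 2 ≠ 0 := by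
    rcases h with h | h <;> positivity
  refine ⟨!₂[c * a / (a ^ 2 + b ^ 2), c * b / (a ^ 2 + b ^ 2)], !₂[-b, a], ?_, ?_⟩
  · intro h0
    have e0 := congrArg (fun v : Plane => v 0) h0
    have e1 := congrArg (fun v : Plane => v 1) h0
    simp at e0 e1
    rcases h with h | h
    · exact h e1
    · exact h e0
  · ext z
    simp only [Set.mem_ofPred_eq]
    constructor
    · intro hz
      refine ⟨(a * z 1 - b * z 0) / (a ^ 2 + b ^ 2), ?_⟩
      ext i
      fin_cases i
      · simp
        field_simp
        rw [← hz]; ring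
      · simp
        field_simp
        rw [← hz]; ring
    · rintro ⟨t, rfl⟩
      simp
      field_simp
      ring

end ThreeLines

theorem stmt_2 (F : Set (Set Plane))
    (hne : ∀ S ∈ F, S.Nonempty)
    (hcpt : ∀ S ∈ F, IsCompact S)
    (hconn : ∀ S ∈ F, IsConnected S)
    (htight : ∀ A ∈ F, ∀ B ∈ F, ∀ C ∈ F, Tight A B C) :
    PiercedByLines F 3 := by
  classical
  let hit : Set Plane → (Fin 3 → ℝ × ℝ × ℝ) → Prop := fun S q =>
    ∃ j, ∃ z ∈ S, (q j).1 * z 0 + (q j).2.1 * z 1 = (q j).2.2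
  have hcompact : IsCompact (Set.pi Set.univ fun _ : Fin 3 => Metric.sphere (0 : ℝ × ℝ × ℝ) 1) :=
    isCompact_univ_pi fun _ => isCompact_sphere _ _
  have hclosed : ∀ S : F, IsClosed {q | hit S.1 q} := by
    intro S
    have : {q | hit S.1 q} = ⋃ j : Fin 3, {q | ∃ z ∈ S.1, (q j).1 * z 0 + (q j).2.1 * z 1 = (q j).2.2} := by
      ext q; simp [hit]
    rw [this]
    apply isClosed_iUnion_of_finite
    intro j
    rw [← isOpen_compl_iff, isOpen_iff_eventually]
    intro q hq
    simp only [Set.mem_compl_iff, Set.mem_ofPred_eq, not_exists, not_and] at hq ⊢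
    have := (hcpt S.1 S.2).eventually_forall_of_forall_eventually (x₀ := q)
        (P := fun q z => ¬ (q j).1 * z 0 + (q j).2.1 * z 1 = (q j).2.2)
        (fun z hz => by
          have ho : IsOpen {p : (Fin 3 → ℝ × ℝ × ℝ) × Plane |
              (p.1 j).1 * p.2 0 + (p.1 j).2.1 * p.2 1 ≠ (p.1 j).2.2} :=
            isOpen_ne_fun (by fun_prop) (by fun_prop)
          exact ho.mem_nhds (x := (q, z)) (hq z hz))
    exact this
  obtain ⟨q, hq, hq'⟩ := hcompact.inter_iInter_nonempty (fun S : F => {q | hit S.1 q}) hclosed (by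
    intro W
    have hcW : IsCompact (⋃ S ∈ W, S.1) := W.isCompact_biUnion fun S _ => hcpt S.1 S.2
    obtain ⟨r, hr0, hr⟩ := hcW.isBounded.exists_pos_norm_le
    obtain ⟨a, b, hab⟩ := ThreeLines.bounded_case (Subtype.val '' (W : Set F)) r hr0.le
      (by
        rintro _ ⟨S, hS, rfl⟩ z hz
        have h1 : ‖z‖ ≤ r := hr z (Set.mem_biUnion hS hz)
        have h2 := EuclideanSpace.real_norm_sq_eq z
        rw [Fin.sum_univ_two] at h2
        rw [← h2]
        gcongr)
      (by rintro _ ⟨S, hS, rfl⟩; exact hcpt S.1 S.2)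
      (by rintro _ ⟨S, hS, rfl⟩; exact hconn S.1 S.2)
      (by
        rintro _ ⟨A, hA, rfl⟩ _ ⟨B, hB, rfl⟩ _ ⟨C, hC, rfl⟩
        exact htight _ A.2 _ B.2 _ C.2)
    let p : Fin 3 → ℝ × ℝ × ℝ := fun j =>
      (Real.cos ((a j + b j) / 2), Real.sin ((a j + b j) / 2), r * Real.cos ((b j - a j) / 2))
    have hp : ∀ j, p j ≠ 0 := by
      intro j h
      have h1 : Real.cos ((a j + b j) / 2) = 0 := congrArg (fun v : ℝ × ℝ × ℝ => v.1) h
      have h2 : Real.sin ((a j + b j) / 2) = 0 := congrArg (fun v : ℝ × ℝ × ℝ => v.2.1) h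
      have := Real.sin_sq_add_cos_sq ((a j + b j) / 2)
      rw [h1, h2] at this
      norm_num at this
    refine ⟨fun j => ‖p j‖⁻¹ • p j, ?_, ?_⟩
    · intro j _
      simp only [mem_sphere_zero_iff_norm, norm_smul, norm_inv, norm_norm]
      exact inv_mul_cancel₀ (norm_ne_zero_iff.2 (hp j))
    · simp only [Set.mem_iInter, Set.mem_ofPred_eq]
      intro S hS
      obtain ⟨j, z, hz, h⟩ := hab S.1 ⟨S, hS, rfl⟩
      refine ⟨j, z, hz, ?_⟩
      unfold ThreeLines.G at h
      simp only [Prod.smul_fst, Prod.smul_snd, smul_eq_mul, p]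
      linear_combination (‖p j‖⁻¹) * h)
  refine ⟨fun j => if (q j).1 ≠ 0 ∨ (q j).2.1 ≠ 0 then
      {z : Plane | (q j).1 * z 0 + (q j).2.1 * z 1 = (q j).2.2}
    else {z : Plane | 1 * z 0 + 0 * z 1 = 0}, ?_, ?_⟩
  · intro j
    dsimp only
    split_ifs with h
    · exact ThreeLines.isLine_of _ h
    · exact ThreeLines.isLine_of _ (Or.inl one_ne_zero)
  · intro S hS
    have hh : hit S q := Set.mem_iInter.1 hq' ⟨S, hS⟩
    obtain ⟨j, z, hz, h⟩ := hh
    refine ⟨z, hz, Set.mem_iUnion.2 ⟨j, ?_⟩⟩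
    have hcase : (q j).1 ≠ 0 ∨ (q j).2.1 ≠ 0 := by
      by_contra hcon
      push Not at hcon
      rw [hcon.1, hcon.2] at h
      have h3 : (q j).2.2 = 0 := by linarith
      have h4 : q j = 0 := Prod.ext hcon.1 (Prod.ext hcon.2 h3)
      have h5 := hq j (Set.mem_univ j)
      rw [h4] at h5
      simp at h5
    simp only [if_pos hcase]
    exact h
end
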